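/- arXiv:2310.20591 — 6 statements merged into one kernel-verified Lean document; each statement's English description precedes it below -/
import Mathlib

section
/- Let 0 → M' → M → M'' → 0 be a short exact sequence of sheaves of A-modules on a topological space X, where A is a sheaf of rings. If M' and M'' are locally finitely generated over A, then M is locally finitely generated over A. -/
/-!
Finiteness conditions for sheaves of modules over a sheaf of rings on a
topological space `X`, following the paper. We use the Grothendieck topology
on `Opens X`; the restriction of a sheaf of modules to an open subset `U`
is given by `SheafOfModules.over`, and the further restriction of a sheaf of
`A|_U`-modules to a smaller open `V ≤ U` is given by pushforward to the
site `(J.over U).over V`.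
-/

universe u

open CategoryTheory Limits TopologicalSpace

namespace CoherentSheaves

variable {X : TopCat.{u}} {R : Sheaf (Opens.grothendieckTopology X) RingCat.{u}}

/-- The restriction of a sheaf of `A|_U`-modules to a smaller open `V ≤ U`. -/
noncomputable abbrev resOver {U : Opens X} (N : SheafOfModules.{u} (R.over U))
    {V : Opens X} (h : V ≤ U) :
    SheafOfModules.{u} ((R.over U).over (Over.mk (homOfLE h))) :=
  N.over (Over.mk (homOfLE h))

/-- The restriction of a morphism of sheaves of modules to an open subset `U`. -/
noncomputable abbrev resMap {M N : SheafOfModules.{u} R} (φ : M ⟶ N) (U : Opens X) :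
    M.over U ⟶ N.over U :=
  (SheafOfModules.pushforward (𝟙 _)).map φ

/-- A sheaf of `A|_U`-modules `N` is locally finitely generated if every `x ∈ U` has an
open neighborhood `V ≤ U` on which `N` admits an epimorphism from a finite free module. -/
def IsLFGOver {U : Opens X} (N : SheafOfModules.{u} (R.over U)) : Prop :=
  ∀ x ∈ U, ∃ (V : Opens X) (h : V ≤ U), x ∈ V ∧ ∃ n : ℕ, 0 < n ∧
    ∃ p : SheafOfModules.free (ULift.{u} (Fin n)) ⟶ resOver N h, Epi p

/-- A sheaf of `A|_U`-modules `N` is locally finitely presented if every `x ∈ U` has an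
open neighborhood `V ≤ U` on which there is an exact sequence
`(A|_V)^{⊕m} ⟶ (A|_V)^{⊕n} ⟶ N|_V ⟶ 0`. -/
def IsLFPOver {U : Opens X} (N : SheafOfModules.{u} (R.over U)) : Prop :=
  ∀ x ∈ U, ∃ (V : Opens X) (h : V ≤ U), x ∈ V ∧ ∃ m n : ℕ, 0 < m ∧ 0 < n ∧
    ∃ (f : (SheafOfModules.free (ULift.{u} (Fin m)) :
              SheafOfModules.{u} ((R.over U).over (Over.mk (homOfLE h)))) ⟶
             SheafOfModules.free (ULift.{u} (Fin n)))
      (p : SheafOfModules.free (ULift.{u} (Fin n)) ⟶ resOver N h)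
      (w : f ≫ p = 0), Epi p ∧ (ShortComplex.mk f p w).Exact

/-- A sheaf of `A`-modules `M` is locally finitely generated if every `x ∈ X` has an
open neighborhood `U` on which `M` admits an epimorphism from a finite free module. -/
def IsLFG (M : SheafOfModules.{u} R) : Prop :=
  ∀ x : X, ∃ U : Opens X, x ∈ U ∧ ∃ n : ℕ, 0 < n ∧
    ∃ p : SheafOfModules.free (ULift.{u} (Fin n)) ⟶ M.over U, Epi p

/-- A sheaf of `A`-modules `M` is locally finitely presented if every `x ∈ X` has an
open neighborhood `U` on which there is an exact sequence
`(A|_U)^{⊕m} ⟶ (A|_U)^{⊕n} ⟶ M|_U ⟶ 0`. -/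
def IsLFP (M : SheafOfModules.{u} R) : Prop :=
  ∀ x : X, ∃ U : Opens X, x ∈ U ∧ ∃ m n : ℕ, 0 < m ∧ 0 < n ∧
    ∃ (f : (SheafOfModules.free (ULift.{u} (Fin m)) :
              SheafOfModules.{u} (R.over U)) ⟶ SheafOfModules.free (ULift.{u} (Fin n)))
      (p : SheafOfModules.free (ULift.{u} (Fin n)) ⟶ M.over U)
      (w : f ≫ p = 0), Epi p ∧ (ShortComplex.mk f p w).Exact

/-- A sheaf of `A`-modules `M` is pseudo-coherent if for every open `U`, every locally
finitely generated `A|_U`-submodule of `M|_U` is locally finitely presented. -/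
def IsPseudoCoherent (M : SheafOfModules.{u} R) : Prop :=
  ∀ (U : Opens X) (N : SheafOfModules.{u} (R.over U)) (ι : N ⟶ M.over U),
    Mono ι → IsLFGOver N → IsLFPOver N

/-- A sheaf of `A`-modules is coherent if it is locally finitely generated
and pseudo-coherent. -/
def IsCoherent (M : SheafOfModules.{u} R) : Prop :=
  IsLFG M ∧ IsPseudoCoherent M

noncomputable section

section

universe v u'
variable {C : Type u'} [Category.{v} C] {J : GrothendieckTopology C} {A : Sheaf J RingCat.{u}}

instance preservesEpimorphisms_toSheaf [HasSheafify J AddCommGrpCat.{u}]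
    [J.WEqualsLocallyBijective AddCommGrpCat.{u}] :
    (SheafOfModules.toSheaf.{u} A).PreservesEpimorphisms where
  preserves {M N} g _ := by
    let a := PresheafOfModules.sheafification.{u} (𝟙 A.obj)
    let G := SheafOfModules.forget.{u} A ⋙ PresheafOfModules.restrictScalars (𝟙 A.obj)
    let adj : a ⊣ G := PresheafOfModules.sheafificationAdjunction.{u} (𝟙 A.obj)
    let T := SheafOfModules.toSheaf.{u} A
    have : IsIso adj.counit :=
      inferInstanceAs (IsIso (PresheafOfModules.sheafificationAdjunction.{u} (𝟙 A.obj)).counit)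
    have e : a.map (G.map g) = adj.counit.app M ≫ g ≫ inv (adj.counit.app N) := by
      simp [← Category.assoc]
    have h₁ : Epi (a.map (G.map g)) := by
      rw [e]
      exact epi_comp' inferInstance (epi_comp' ‹_› inferInstance)
    have h₂ : Epi (a.map (Abelian.image.ι (G.map g))) := by
      rw [← Abelian.image.fac (G.map g), a.map_comp] at h₁
      exact epi_of_epi (a.map (Abelian.factorThruImage (G.map g))) _
    have h₃ : IsIso (a.map (Abelian.image.ι (G.map g))) := isIso_of_mono_of_epi _
    have h₄ : Epi (T.map (a.map (Abelian.factorThruImage (G.map g)))) :=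
      inferInstanceAs (Epi ((PresheafOfModules.toPresheaf _ ⋙
        presheafToSheaf J AddCommGrpCat).map (Abelian.factorThruImage (G.map g))))
    have h₅ : Epi (T.map (a.map (G.map g))) := by
      rw [← Abelian.image.fac (G.map g), a.map_comp, T.map_comp]
      infer_instance
    have h₆ : g = (inv (adj.counit.app M) ≫ a.map (G.map g)) ≫ adj.counit.app N := by simp [e]
    change Epi (T.map g)
    rw [h₆, T.map_comp, T.map_comp]
    infer_instance

end

/-- Finitely many sections of the target of an epimorphism lift simultaneously on a neighborhood
of any given point. -/
theorem exists_lift {M N : SheafOfModules.{u} R} (g : M ⟶ N) [Epi g]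
    {ι : Type*} [Finite ι] {U : Opens X} (s : ι → N.val.obj (.op U)) {x : X} (hx : x ∈ U) :
    ∃ (V : Opens X) (h : V ≤ U), x ∈ V ∧ ∃ t : ι → M.val.obj (.op V),
      ∀ i, g.val.app _ (t i) = N.val.map (homOfLE h).op (s i) := by
  have hg : Sheaf.IsLocallySurjective ((SheafOfModules.toSheaf R).map g) := by
    rw [Sheaf.isLocallySurjective_iff_epi']
    infer_instance
  have key (i : ι) : ∃ (V : Opens X) (h : V ≤ U), x ∈ V ∧ ∃ t : M.val.obj (.op V),
      g.val.app _ t = N.val.map (homOfLE h).op (s i) := by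
    obtain ⟨V, f, ⟨t, ht⟩, hV⟩ := hg.imageSieve_mem (U := U) (s i) x hx
    exact ⟨V, f.le, hV, t, ht⟩
  choose V h hV t ht using key
  have := Fintype.ofFinite ι
  refine ⟨U ⊓ Finset.univ.inf V, inf_le_left, ⟨hx, ?_⟩,
    fun i ↦ M.val.map (homOfLE (inf_le_right.trans (Finset.inf_le (Finset.mem_univ i)))).op (t i),
    fun i ↦ ?_⟩
  · simpa using hV
  · rw [PresheafOfModules.naturality_apply, ht]
    exact (PresheafOfModules.map_comp_apply N.val (homOfLE (h i)).op
      (homOfLE (inf_le_right.trans (Finset.inf_le (Finset.mem_univ i)))).op (s i)).symm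

/-- The global section of `M.over U` corresponding to an element of `M(U)`. -/
def overSection (M : SheafOfModules.{u} R) {U : Opens X} (t : M.val.obj (.op U)) :
    (M.over U).sections :=
  PresheafOfModules.sectionsMk (fun W ↦ M.val.map W.unop.hom.op t) fun W _ f ↦
    (PresheafOfModules.map_comp_apply M.val W.unop.hom.op f.unop.left.op t).symm

theorem overSection_eval {M : SheafOfModules.{u} R} {U : Opens X} (s : (M.over U).sections) :
    overSection M (s.eval (.op (Over.mk (𝟙 U)))) = s := by
  exact PresheafOfModules.sections_ext _ _ fun W ↦
    PresheafOfModules.sections_property s (Over.homMk (V := .mk (𝟙 U)) W.unop.hom).op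

theorem sectionsMap_overSection {M N : SheafOfModules.{u} R} (g : M ⟶ N) {U : Opens X}
    (t : M.val.obj (.op U)) :
    SheafOfModules.sectionsMap (g.over U) (overSection M t) = overSection N (g.val.app _ t) := by
  exact PresheafOfModules.sections_ext _ _ fun W ↦
    PresheafOfModules.naturality_apply g.val W.unop.hom.op t

/-- Sections which generate `M` on `U` generate it on every smaller open subset. -/
theorem epi_restrict {M : SheafOfModules.{u} R} {ι : Type u} {U V : Opens X} (h : V ≤ U)
    (s : ι → M.val.obj (.op U))
    (hs : Epi ((M.over U).freeHomEquiv.symm fun i ↦ overSection M (s i))) :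
    Epi ((M.over V).freeHomEquiv.symm fun i ↦
      overSection M (M.val.map (homOfLE h).op (s i))) := by
  let F := SheafOfModules.overMap R (homOfLE h)
  let e := SheafOfModules.mapFreeIso F ι (SheafOfModules.overMapUnitIso (homOfLE h)).symm
  let k := (SheafOfModules.overFunctorMap R (homOfLE h)).app M
  have : Epi (e.hom ≫ F.map ((M.over U).freeHomEquiv.symm fun i ↦ overSection M (s i)) ≫ k.hom) :=
    inferInstance
  convert this
  rw [Equiv.symm_apply_eq]
  ext i : 1
  refine .trans ?_ (congr((M.over V).unitHomEquiv ($(SheafOfModules.ιFree_mapFreeIso_hom F ι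
    (SheafOfModules.overMapUnitIso (homOfLE h)).symm i) ≫
      F.map ((M.over U).freeHomEquiv.symm fun i ↦ overSection M (s i)) ≫ k.hom))).symm
  refine PresheafOfModules.sections_ext _ _ fun W ↦ ?_
  have H : (M.over U).freeHomEquiv ((M.over U).freeHomEquiv.symm fun i ↦ overSection M (s i)) i =
      overSection M (s i) := by simp
  refine .trans ?_ congr(($H).eval (.op ((Over.map (homOfLE h)).obj W.unop))).symm
  exact (PresheafOfModules.map_comp_apply M.val (homOfLE h).op W.unop.hom.op (s i)).symm

/-- Sections generate `M` if and only if morphisms out of `M` which kill them vanish. -/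
theorem epi_freeHomEquiv_symm_iff {C : Type*} [Category* C] {J : GrothendieckTopology C}
    {A : Sheaf J RingCat.{u}} [HasSheafify J AddCommGrpCat.{u}]
    [J.WEqualsLocallyBijective AddCommGrpCat.{u}] {M : SheafOfModules.{u} A} {ι : Type u}
    (s : ι → M.sections) :
    Epi (M.freeHomEquiv.symm s) ↔ ∀ ⦃N : SheafOfModules.{u} A⦄ (r : M ⟶ N),
      (∀ i, M.unitHomEquiv.symm (s i) ≫ r = 0) → r = 0 := by
  have h (i : ι) : SheafOfModules.ιFree i ≫ M.freeHomEquiv.symm s = M.unitHomEquiv.symm (s i) := by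
    rw [← SheafOfModules.unitHomEquiv_symm_freeHomEquiv_apply, Equiv.apply_symm_apply]
  rw [Preadditive.epi_iff_cancel_zero]
  refine forall₂_congr fun N r ↦ imp_congr ?_ .rfl
  refine ⟨fun hr i ↦ ?_, fun hr ↦
    Cofan.IsColimit.hom_ext (SheafOfModules.isColimitFreeCofan ι) _ _ fun i ↦ ?_⟩
  · rw [← h, Category.assoc, hr, comp_zero]
  · exact (reassoc_of% (h i)) r |>.trans ((hr i).trans comp_zero.symm)

/-- Given a short exact sequence, the images of generators of `S.X₁` on `U` together with lifts of
generators of `S.X₃` on `U` generate `S.X₂` on `U`. -/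
theorem epi_of_shortExact {S : ShortComplex (SheafOfModules.{u} R)} (hS : S.ShortExact)
    {U : Opens X} {ι κ τ : Type u} (a : ι → S.X₁.val.obj (.op U)) (b : κ → S.X₂.val.obj (.op U))
    (ha : Epi ((S.X₁.over U).freeHomEquiv.symm fun i ↦ overSection S.X₁ (a i)))
    (hb : Epi ((S.X₃.over U).freeHomEquiv.symm fun j ↦ overSection S.X₃ (S.g.val.app _ (b j))))
    (e : τ ≃ ι ⊕ κ) :
    Epi ((S.X₂.over U).freeHomEquiv.symm fun k ↦
      overSection S.X₂ (Sum.elim (fun i ↦ S.f.val.app _ (a i)) b (e k))) := by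
  rw [epi_freeHomEquiv_symm_iff] at ha hb ⊢
  intro N r hr
  let F := SheafOfModules.overFunctor R U
  have : F.IsLeftAdjoint :=
    inferInstanceAs (SheafOfModules.pushforward.{u} (𝟙 (R.over U))).IsLeftAdjoint
  have hr₁ : S.f.over U ≫ r = 0 := ha _ fun i ↦ by
    simpa [reassoc_of% SheafOfModules.unitHomEquiv_symm_comp, sectionsMap_overSection]
      using hr (e.symm (.inl i))
  have hc := CokernelCofork.mapIsColimit _ hS.gIsCokernel F
  obtain ⟨r', hr'⟩ : ∃ r' : S.X₃.over U ⟶ N, S.g.over U ≫ r' = r :=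
    ⟨hc.desc (CokernelCofork.ofπ r hr₁), hc.fac (CokernelCofork.ofπ r hr₁) .one⟩
  have : r' = 0 := hb _ fun j ↦ by
    rw [← sectionsMap_overSection, ← SheafOfModules.unitHomEquiv_symm_comp, Category.assoc, hr']
    simpa using hr (e.symm (.inr j))
  rw [← hr', this, comp_zero]

/-- A locally finitely generated sheaf is generated by finitely many sections near each point. -/
theorem exists_sections {M : SheafOfModules.{u} R} (hM : IsLFG M) (x : X) :
    ∃ U : Opens X, x ∈ U ∧ ∃ n : ℕ, 0 < n ∧ ∃ s : ULift.{u} (Fin n) → M.val.obj (.op U),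
      Epi ((M.over U).freeHomEquiv.symm fun i ↦ overSection M (s i)) := by
  obtain ⟨U, hU, n, hn, p, hp⟩ := hM x
  refine ⟨U, hU, n, hn, fun i ↦ ((M.over U).freeHomEquiv p i).eval (.op (Over.mk (𝟙 U))), ?_⟩
  have h : (M.over U).freeHomEquiv.symm (fun i ↦
      overSection M (((M.over U).freeHomEquiv p i).eval (.op (Over.mk (𝟙 U))))) = p :=
    (Equiv.symm_apply_eq _).2 (funext fun i ↦ overSection_eval _)
  exact h.symm ▸ hp

end

/-- If `0 ⟶ M' ⟶ M ⟶ M'' ⟶ 0` is short exact and `M'`, `M''` are locally finitely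
generated, then so is `M`. -/
theorem isLFG_of_isLFG_isLFG (S : CategoryTheory.ShortComplex (SheafOfModules.{u} R)) (hS : S.ShortExact)
    (hM' : IsLFG S.X₁) (hM'' : IsLFG S.X₃) : IsLFG S.X₂ := by
  intro x
  obtain ⟨U, hxU, n, hn, a, ha⟩ := exists_sections hM' x
  obtain ⟨U', hxU', m, -, c, hc⟩ := exists_sections hM'' x
  have : Epi S.g := hS.epi_g
  obtain ⟨V, hVU', hxV, b, hb⟩ := exists_lift S.g c hxU'
  let a' (i) : S.X₁.val.obj (.op (U ⊓ V)) := S.X₁.val.map (homOfLE inf_le_left).op (a i)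
  let b' (j) : S.X₂.val.obj (.op (U ⊓ V)) := S.X₂.val.map (homOfLE inf_le_right).op (b j)
  have ha' : Epi ((S.X₁.over (U ⊓ V)).freeHomEquiv.symm fun i ↦ overSection S.X₁ (a' i)) :=
    epi_restrict inf_le_left a ha
  have hb₀ : Epi ((S.X₃.over V).freeHomEquiv.symm
      fun j ↦ overSection S.X₃ (S.g.val.app _ (b j))) := by
    simp only [hb]
    exact epi_restrict hVU' c hc
  have hb' : Epi ((S.X₃.over (U ⊓ V)).freeHomEquiv.symm
      fun j ↦ overSection S.X₃ (S.g.val.app _ (b' j))) := by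
    have H (j) : S.g.val.app _ (b' j) =
        S.X₃.val.map (homOfLE inf_le_right).op (S.g.val.app _ (b j)) :=
      PresheafOfModules.naturality_apply S.g.val (homOfLE inf_le_right).op (b j)
    simp only [H]
    exact epi_restrict inf_le_right (fun j ↦ S.g.val.app _ (b j)) hb₀
  let e : ULift.{u} (Fin (n + m)) ≃ ULift.{u} (Fin n) ⊕ ULift.{u} (Fin m) :=
    Equiv.ulift.trans (finSumFinEquiv.symm.trans (Equiv.sumCongr Equiv.ulift Equiv.ulift).symm)
  exact ⟨U ⊓ V, ⟨hxU, hxV⟩, n + m, by omega, _, epi_of_shortExact hS a' b' ha' hb' e⟩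

end CoherentSheaves
end

section
/- Let A be a sheaf of rings on a topological space X, φ : M ↠ N an epimorphism of sheaves of A-modules, n a positive integer, and f : A^{⊕n} → N a morphism of sheaves of A-modules. Then for any x ∈ X there exists an open neighborhood U of x and a morphism g : (A|_U)^{⊕n} → M|_U such that φ|_U ∘ g = f|_U. -/
/-!
Finiteness conditions for sheaves of modules over a sheaf of rings on a
topological space `X`, following the paper. We use the Grothendieck topology
on `Opens X`; the restriction of a sheaf of modules to an open subset `U`
is given by `SheafOfModules.over`, and the further restriction of a sheaf of
`A|_U`-modules to a smaller open `V ≤ U` is given by pushforward to the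
site `(J.over U).over V`.
-/

universe u

open CategoryTheory Limits TopologicalSpace

namespace CoherentSheaves

variable {X : TopCat.{u}} {R : Sheaf (Opens.grothendieckTopology X) RingCat.{u}}

/-- Forgetting the module structure of sheaves of modules preserves epimorphisms. -/
instance toSheaf_preservesEpimorphisms :
    (SheafOfModules.toSheaf.{u} R).PreservesEpimorphisms where
  preserves {M N} φ _ := by
    let a := PresheafOfModules.sheafification.{u} (𝟙 R.obj)
    let F := SheafOfModules.toSheaf.{u} R
    let c := asIso (PresheafOfModules.sheafificationAdjunction.{u} (𝟙 R.obj)).counit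
    obtain ⟨cM, cN, hc⟩ : ∃ (cM : a.obj M.val ≅ M) (cN : a.obj N.val ≅ N),
        a.map φ.val ≫ cN.hom = cM.hom ≫ φ := ⟨c.app M, c.app N, c.hom.naturality φ⟩
    have hφ : φ = cM.inv ≫ a.map φ.val ≫ cN.hom := by rw [hc, Iso.inv_hom_id_assoc]
    have : Epi (a.map φ.val) := by
      rw [(Iso.eq_comp_inv cN).2 hc]
      infer_instance
    have : Epi (a.map (image.ι φ.val)) := by
      have : Epi (a.map (factorThruImage φ.val) ≫ a.map (image.ι φ.val)) := by
        rwa [← a.map_comp, image.fac]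
      exact epi_of_epi (a.map (factorThruImage φ.val)) _
    have : IsIso (a.map (image.ι φ.val)) := isIso_of_mono_of_epi _
    have : Epi (F.map (a.map (factorThruImage φ.val))) :=
      inferInstanceAs (Epi ((PresheafOfModules.toPresheaf R.obj ⋙ presheafToSheaf _ _).map
        (factorThruImage φ.val)))
    have : Epi (F.map (a.map φ.val)) := by
      rw [← image.fac φ.val, a.map_comp, F.map_comp]
      infer_instance
    rw [hφ, F.map_comp, F.map_comp]
    infer_instance

/-- Every section of the target of an epimorphism of sheaves of modules lifts locally. -/
lemma exists_local_preimage {M N : SheafOfModules.{u} R} (φ : M ⟶ N) [Epi φ]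
    (s : N.sections) (x : X) :
    ∃ U : Opens X, x ∈ U ∧ ∃ t : M.val.obj (.op U), φ.val.app (.op U) t = s.val (.op U) := by
  have : Sheaf.IsLocallySurjective ((SheafOfModules.toSheaf.{u} R).map φ) :=
    (Sheaf.isLocallySurjective_iff_epi' _ _).2 inferInstance
  obtain ⟨U, i, ⟨t, ht⟩, hx⟩ := Presheaf.imageSieve_mem (Opens.grothendieckTopology X)
    ((SheafOfModules.toSheaf.{u} R).map φ).hom (U := .op ⊤) (s.val (.op ⊤)) x trivial
  exact ⟨U, hx, t, ht.trans (s.property i.op)⟩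

/-- If `t` is a preimage of a section, then so are its restrictions. -/
lemma app_map_eq {M N : SheafOfModules.{u} R} (φ : M ⟶ N) {s : N.sections}
    {U V : (Opens X)ᵒᵖ} {t : M.val.obj U} (h : φ.val.app U t = s.val U) (i : U ⟶ V) :
    φ.val.app V (M.val.map i t) = s.val V :=
  (PresheafOfModules.naturality_apply φ.val i t).trans
    ((congrArg (N.val.map i) h).trans (s.property i))

/-- The section of `M|_U` given by an element of `M(U)`. -/
noncomputable def sectionOver (M : SheafOfModules.{u} R) (U : Opens X) (t : M.val.obj (.op U)) :
    (M.over U).sections where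
  val V := M.val.map V.unop.hom.op t
  property {V W} i := by
    change M.val.map i.unop.left.op (M.val.map V.unop.hom.op t) = M.val.map W.unop.hom.op t
    exact (ConcreteCategory.congr_hom (M.val.presheaf.map_comp V.unop.hom.op i.unop.left.op) t).symm

/-- The restriction to `U` of a free sheaf of modules is free. -/
noncomputable def freeOverIso (I : Type u) (U : Opens X) :
    (SheafOfModules.free I : SheafOfModules.{u} (R.over U)) ≅
      (SheafOfModules.free I : SheafOfModules.{u} R).over U :=
  SheafOfModules.mapFreeIso (SheafOfModules.pushforward.{u} (𝟙 (R.over U))) I (Iso.refl _)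

lemma freeHomEquiv_freeOverIso_hom_comp {N : SheafOfModules.{u} R} {I : Type u}
    (f : SheafOfModules.free I ⟶ N) (U : Opens X) (i : I) :
    (N.over U).freeHomEquiv ((freeOverIso I U).hom ≫ resMap f U) i =
      SheafOfModules.pushforwardSections (𝟙 (R.over U)) (N.freeHomEquiv f i) := by
  change (N.over U).unitHomEquiv (SheafOfModules.ιFree i ≫ (freeOverIso I U).hom ≫ resMap f U) =
    SheafOfModules.pushforwardSections (𝟙 (R.over U)) (N.unitHomEquiv (SheafOfModules.ιFree i ≫ f))
  rw [SheafOfModules.pushforwardSections_unitHomEquiv, Functor.map_comp]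
  congr 1
  exact SheafOfModules.ιFree_mapFreeIso_hom_assoc _ _ _ _ _

/-- A morphism `f : A^{⊕n} ⟶ N` lifts locally along any epimorphism `φ : M ↠ N`. -/
theorem exists_local_lift_free (M N : SheafOfModules.{u} R) (φ : M ⟶ N) [Epi φ]
    (n : ℕ) (hn : 0 < n) (f : (SheafOfModules.free (ULift.{u} (Fin n)) : SheafOfModules.{u} R) ⟶ N) (x : X) :
    ∃ U : Opens X, x ∈ U ∧
      ∃ g : (SheafOfModules.free (ULift.{u} (Fin n)) : SheafOfModules.{u} R).over U ⟶ M.over U,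
        g ≫ resMap φ U = resMap f U := by
  choose U hxU t ht using fun i ↦ exists_local_preimage φ (N.freeHomEquiv f i) x
  let V : Opens X := ⨅ i, U i
  have hV (i) : V ≤ U i := iInf_le _ _
  let s (i) : (M.over V).sections := sectionOver M V (M.val.map (homOfLE (hV i)).op (t i))
  refine ⟨V, ?_, (freeOverIso _ V).inv ≫ (M.over V).freeHomEquiv.symm s, ?_⟩
  · rw [← SetLike.mem_coe, Opens.coe_iInf]
    simpa using hxU
  rw [Category.assoc, Iso.inv_comp_eq, SheafOfModules.freeHomEquiv_symm_comp,
    Equiv.symm_apply_eq]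
  ext i W
  rw [freeHomEquiv_freeOverIso_hom_comp]
  have h : φ.val.app (.op V) (M.val.map (homOfLE (hV i)).op (t i)) =
      (N.freeHomEquiv f i).val (.op V) := app_map_eq φ (ht i) _
  exact app_map_eq φ h W.unop.hom.op

end CoherentSheaves
end

section
/- Let 0 → M' → M → M'' → 0 be a short exact sequence of sheaves of A-modules. If M is locally finitely presented over A and M' is locally finitely generated over A, then M'' is locally finitely presented over A. -/
/-!
Finiteness conditions for sheaves of modules over a sheaf of rings on a
topological space `X`, following the paper. We use the Grothendieck topology
on `Opens X`; the restriction of a sheaf of modules to an open subset `U`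
is given by `SheafOfModules.over`, and the further restriction of a sheaf of
`A|_U`-modules to a smaller open `V ≤ U` is given by pushforward to the
site `(J.over U).over V`.
-/

universe u

open CategoryTheory Limits TopologicalSpace

namespace CategoryTheory.CokernelCofork

variable {C : Type*} [Category* C] [Preadditive C] [HasBinaryCoproducts C]

/-- If `p` is a cokernel of `f`, `g` is a cokernel of `i`, and `l` lifts `q ≫ i` along `p`
with `q` an epimorphism, then `p ≫ g` is a cokernel of `f` and `l` together. -/
noncomputable def isColimitDescComp {A B D M' M M'' : C} {f : A ⟶ B} {p : B ⟶ M}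
    {w : f ≫ p = 0} (hp : IsColimit (CokernelCofork.ofπ p w))
    {i : M' ⟶ M} {g : M ⟶ M''} {w' : i ≫ g = 0} (hg : IsColimit (CokernelCofork.ofπ g w'))
    (q : D ⟶ M') [Epi q] (l : D ⟶ B) (hl : l ≫ p = q ≫ i)
    (w'' : coprod.desc f l ≫ p ≫ g = 0) :
    IsColimit (CokernelCofork.ofπ (p ≫ g) w'') :=
  haveI : Epi p := epi_of_isColimit_cofork hp
  haveI : Epi g := epi_of_isColimit_cofork hg
  CokernelCofork.IsColimit.ofπ' _ _ fun {Z} h hh ↦ by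
    have h₁ : f ≫ h = 0 := (coprod.inl_desc_assoc f l h).symm.trans (by rw [hh, comp_zero])
    have h₂ : l ≫ h = 0 := (coprod.inr_desc_assoc f l h).symm.trans (by rw [hh, comp_zero])
    obtain ⟨k, hk⟩ := CokernelCofork.IsColimit.desc' hp h h₁
    obtain ⟨k', hk'⟩ := CokernelCofork.IsColimit.desc' hg k (by
      rw [← cancel_epi q, ← reassoc_of% hl, comp_zero]
      exact (l ≫= hk).trans h₂)
    exact ⟨k', by rw [Category.assoc]; exact (p ≫= hk').trans hk⟩

end CategoryTheory.CokernelCofork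

namespace SheafOfModules

section

variable {C : Type*} [Category* C] {J : GrothendieckTopology C} {R : Sheaf J RingCat.{u}}
  [HasSheafify J AddCommGrpCat.{u}] [J.WEqualsLocallyBijective AddCommGrpCat.{u}]

instance toSheaf_map_epi {M N : SheafOfModules.{u} R} (p : M ⟶ N) [Epi p] :
    Epi ((toSheaf R).map p) := by
  let a := PresheafOfModules.sheafification.{u} (𝟙 R.obj)
  let adj := PresheafOfModules.sheafificationAdjunction.{u} (𝟙 R.obj)
  let G := SheafOfModules.forget.{u} R ⋙ PresheafOfModules.restrictScalars (𝟙 R.obj)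
  have e : Arrow.mk (a.map (G.map p)) ≅ Arrow.mk p :=
    ((Functor.mapArrowFunctor _ _).mapIso (asIso adj.counit)).app (Arrow.mk p)
  have h₁ : Epi (a.map (G.map p)) :=
    ((MorphismProperty.epimorphisms _).arrow_mk_iso_iff e).2 ‹Epi p›
  have h₂ : a.map (G.map p) = a.map (Abelian.factorThruImage (G.map p)) ≫
      a.map (Abelian.image.ι (G.map p)) := by
    rw [← a.map_comp, Abelian.image.fac]
  have h₃ : Epi (a.map (Abelian.image.ι (G.map p))) := by
    rw [h₂] at h₁
    exact epi_of_epi (a.map (Abelian.factorThruImage (G.map p))) _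
  have h₄ : IsIso (a.map (Abelian.image.ι (G.map p))) := isIso_of_mono_of_epi _
  have h₅ : Epi ((toSheaf R).map (a.map (Abelian.factorThruImage (G.map p)))) :=
    inferInstanceAs (Epi ((PresheafOfModules.toPresheaf _ ⋙ presheafToSheaf J _).map
      (Abelian.factorThruImage (G.map p))))
  have h₆ : Epi ((toSheaf R).map (a.map (G.map p))) := by
    rw [h₂, Functor.map_comp]
    infer_instance
  exact ((MorphismProperty.epimorphisms _).arrow_mk_iso_iff
    ((toSheaf R).mapArrow.mapIso e)).1 h₆

lemma imageSieve_mem_of_epi {M N : SheafOfModules.{u} R} (p : M ⟶ N) [Epi p] {X : C}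
    (s : N.val.obj (.op X)) :
    Presheaf.imageSieve ((PresheafOfModules.toPresheaf R.obj).map p.val) s ∈ J X := by
  have : Sheaf.IsLocallySurjective ((toSheaf R).map p) :=
    (Sheaf.isLocallySurjective_iff_epi' _ _).2 inferInstance
  exact Presheaf.imageSieve_mem J ((toSheaf R).map p).hom s

end

section

variable {C : Type*} [Category* C] {J : GrothendieckTopology C} {R : Sheaf J RingCat.{u}}

/-- The restriction of a section of `M` over `Y` to a section over `X`, for `f : X ⟶ Y`. -/
noncomputable def overMapSections {X Y : C} (f : X ⟶ Y) {M : SheafOfModules.{u} (R.over Y)}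
    (t : M.sections) : ((overMap R f).obj M).sections :=
  PresheafOfModules.sectionsMk (fun Z ↦ t.val (.op ((Over.map f).obj Z.unop)))
    (fun _ _ φ ↦ PresheafOfModules.sections_property t ((Over.map f).map φ.unop).op)

/-- The section of the restriction of `M` to `X` that is given by an element of `M(f)`,
for `f : X ⟶ Y`. -/
noncomputable def overMapSectionOfElement {X Y : C} (f : X ⟶ Y)
    {M : SheafOfModules.{u} (R.over Y)} (y : M.val.obj (.op (Over.mk f))) :
    ((overMap R f).obj M).sections :=
  PresheafOfModules.sectionsMk
    (fun Z ↦ M.val.map (Over.homMk (U := (Over.map f).obj Z.unop) (V := Over.mk f)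
      Z.unop.hom).op y)
    (fun Z Z' φ ↦ by
      refine (ConcreteCategory.congr_hom (M.val.presheaf.map_comp
        (Over.homMk (U := (Over.map f).obj Z.unop) (V := Over.mk f) Z.unop.hom).op
        ((Over.map f).map φ.unop).op) y).symm.trans ?_
      refine ConcreteCategory.congr_hom (congr_arg M.val.presheaf.map (Quiver.Hom.unop_inj ?_)) y
      ext
      exact Over.w φ.unop)

lemma sectionsMap_overMapSectionOfElement {X Y : C} (f : X ⟶ Y)
    {M N : SheafOfModules.{u} (R.over Y)} (p : N ⟶ M) (y : N.val.obj (.op (Over.mk f)))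
    (t : M.sections) (h : p.val.app _ y = t.val (.op (Over.mk f))) :
    sectionsMap ((overMap R f).map p) (overMapSectionOfElement f y) = overMapSections f t := by
  refine PresheafOfModules.sections_ext _ _ fun Z ↦ ?_
  let φ := (Over.homMk (U := (Over.map f).obj Z.unop) (V := Over.mk f) Z.unop.hom).op
  exact (PresheafOfModules.naturality_apply p.val φ y).trans
    ((congr_arg (M.val.map φ) h).trans (PresheafOfModules.sections_property t φ))

lemma unitHomEquiv_overMap {X Y : C} (f : X ⟶ Y) {M : SheafOfModules.{u} (R.over Y)}
    (s : unit (R.over Y) ⟶ M) :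
    unitHomEquiv _ ((overMapUnitIso f).inv ≫ (overMap R f).map s) =
      overMapSections f (M.unitHomEquiv s) :=
  rfl

end

end SheafOfModules

namespace CoherentSheaves

variable {X : TopCat.{u}} {R : Sheaf (Opens.grothendieckTopology X) RingCat.{u}}

instance {U V : Opens X} (f : V ⟶ U) : (SheafOfModules.overMap.{u} R f).IsLeftAdjoint := by
  unfold SheafOfModules.overMap
  infer_instance

instance (U : Opens X) : (SheafOfModules.overFunctor.{u} R U).IsLeftAdjoint := by
  unfold SheafOfModules.overFunctor
  infer_instance

lemma exists_free_lift {U : Opens X} {M N : SheafOfModules.{u} (R.over U)} (p : N ⟶ M) [Epi p]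
    {I : Type u} [Finite I] (s : SheafOfModules.free I ⟶ M) {x : X} (hx : x ∈ U) :
    ∃ (V : Opens X) (f : V ⟶ U), x ∈ V ∧
      ∃ l : SheafOfModules.free I ⟶ (SheafOfModules.overMap R f).obj N,
        l ≫ (SheafOfModules.overMap R f).map p =
          SheafOfModules.mapFree _ I (SheafOfModules.overMapUnitIso f).inv ≫
            (SheafOfModules.overMap R f).map s := by
  have h (i : I) : ∃ (W : Opens X) (g : W ⟶ U), x ∈ W ∧ ∃ y : N.val.obj (.op (Over.mk g)),
      p.val.app _ y = (M.freeHomEquiv s i).val (.op (Over.mk g)) := by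
    obtain ⟨W, g, hW, hxW⟩ := SheafOfModules.imageSieve_mem_of_epi p
      ((M.freeHomEquiv s i).val (.op (Over.mk (𝟙 U)))) x hx
    rw [Sieve.overEquiv_iff] at hW
    obtain ⟨y, hy⟩ := hW
    exact ⟨W, g ≫ 𝟙 U, hxW, y,
      hy.trans (PresheafOfModules.sections_property (M.freeHomEquiv s i) _)⟩
  choose W g hxW y hy using h
  let V : Opens X := ⟨(⋂ i, (W i : Set X)) ∩ U,
    (isOpen_iInter_of_finite fun i ↦ (W i).isOpen).inter U.isOpen⟩
  let f : V ⟶ U := homOfLE fun _ h ↦ h.2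
  let r (i : I) : Over.mk f ⟶ Over.mk (g i) :=
    Over.homMk (homOfLE fun _ h ↦ Set.mem_iInter.1 h.1 i)
  have h' (i : I) : ∃ z : N.val.obj (.op (Over.mk f)),
      p.val.app _ z = (M.freeHomEquiv s i).val (.op (Over.mk f)) :=
    ⟨N.val.map (r i).op (y i), (PresheafOfModules.naturality_apply p.val (r i).op (y i)).trans
      ((congr_arg (M.val.map (r i).op) (hy i)).trans
        (PresheafOfModules.sections_property (M.freeHomEquiv s i) _))⟩
  choose z hz using h'
  refine ⟨V, f, ⟨Set.mem_iInter.2 hxW, hx⟩, (SheafOfModules.freeHomEquiv _).symm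
    fun i ↦ SheafOfModules.overMapSectionOfElement f (z i), ?_⟩
  apply (SheafOfModules.freeHomEquiv _).injective
  rw [SheafOfModules.freeHomEquiv_symm_comp, Equiv.apply_symm_apply]
  funext i
  rw [SheafOfModules.sectionsMap_overMapSectionOfElement f p _ _ (hz i)]
  refine (SheafOfModules.unitHomEquiv_overMap f (SheafOfModules.ιFree i ≫ s)).symm.trans ?_
  refine congr_arg (SheafOfModules.unitHomEquiv _) ?_
  rw [SheafOfModules.ιFree_mapFree_assoc, Functor.map_comp]

/-- A right exact sequence `T` whose first two terms are free on finite types gives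
a presentation of `M ≅ T.X₃` in the form used to define `IsLFP`. -/
lemma exists_presentation_of_iso {U : Opens X} {M : SheafOfModules.{u} (R.over U)} {I J : Type u}
    [Finite I] [Nonempty I] [Finite J] [Nonempty J]
    (T : ShortComplex (SheafOfModules.{u} (R.over U))) (hT : T.Exact) [Epi T.g]
    (e₁ : SheafOfModules.free I ≅ T.X₁) (e₂ : SheafOfModules.free J ≅ T.X₂) (e₃ : T.X₃ ≅ M) :
    ∃ m n : ℕ, 0 < m ∧ 0 < n ∧
    ∃ (f : (SheafOfModules.free (ULift.{u} (Fin m)) :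
              SheafOfModules.{u} (R.over U)) ⟶ SheafOfModules.free (ULift.{u} (Fin n)))
      (p : SheafOfModules.free (ULift.{u} (Fin n)) ⟶ M)
      (w : f ≫ p = 0), Epi p ∧ (ShortComplex.mk f p w).Exact := by
  let e (K : Type u) [Finite K] : (SheafOfModules.free (ULift.{u} (Fin (Nat.card K))) :
      SheafOfModules.{u} (R.over U)) ≅ SheafOfModules.free K :=
    SheafOfModules.freeFunctor.mapIso (Equiv.ulift.trans (Finite.equivFin K).symm).toIso
  let S := ShortComplex.mk ((e I ≪≫ e₁).hom ≫ T.f ≫ (e J ≪≫ e₂).inv)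
    ((e J ≪≫ e₂).hom ≫ T.g ≫ e₃.hom) (by simp)
  let iso : S ≅ T :=
    ShortComplex.isoMk (e I ≪≫ e₁) (e J ≪≫ e₂) e₃.symm (by simp [S]) (by simp [S])
  exact ⟨_, _, Nat.card_pos, Nat.card_pos, S.f, S.g, S.zero, epi_comp _ _,
    (ShortComplex.exact_iff_of_iso iso).2 hT⟩

/-- The restriction of a free sheaf of modules is free. -/
noncomputable def overMapFreeIso {U V : Opens X} (f : V ⟶ U) (I : Type u) :
    SheafOfModules.free I ≅
      (SheafOfModules.overMap.{u} R f).obj (SheafOfModules.free I) :=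
  SheafOfModules.mapFreeIso _ I (SheafOfModules.overMapUnitIso f).symm

lemma exists_epi_over {U V : Opens X} (f : V ⟶ U) {M : SheafOfModules.{u} R} {I : Type u}
    (p : SheafOfModules.free I ⟶ M.over U) [Epi p] :
    ∃ q : SheafOfModules.free I ⟶ M.over V, Epi q :=
  ⟨(overMapFreeIso f I).hom ≫ (SheafOfModules.overMap R f).map p ≫
    (SheafOfModules.overFunctorMap R f).hom.app M, inferInstance⟩

/-- In a short exact sequence, if `M` is locally finitely presented and `M'` is locally
finitely generated, then `M''` is locally finitely presented. -/
theorem isLFP_of_isLFP_isLFG (S : CategoryTheory.ShortComplex (SheafOfModules.{u} R)) (hS : S.ShortExact)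
    (hM : IsLFP S.X₂) (hM' : IsLFG S.X₁) : IsLFP S.X₃ := by
  intro x
  obtain ⟨U₁, hx₁, m, n, hm, hn, f, p, w, hp, hf⟩ := hM x
  obtain ⟨U₂, hx₂, k, -, q₀, hq₀⟩ := hM' x
  have : Nonempty (Fin m) := ⟨0, hm⟩
  have : Nonempty (Fin n) := ⟨0, hn⟩
  let U := U₁ ⊓ U₂
  let i₁ : U ⟶ U₁ := homOfLE inf_le_left
  obtain ⟨q, hq⟩ := exists_epi_over (homOfLE inf_le_right : U ⟶ U₂) q₀
  let e (Y) := (SheafOfModules.overFunctorMap R i₁).app Y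
  obtain ⟨V, j, hxV, l, hl⟩ := exists_free_lift ((SheafOfModules.overMap R i₁).map p)
    (q ≫ S.f.over U ≫ (e S.X₂).inv) (x := x) ⟨hx₁, hx₂⟩
  let F := SheafOfModules.overMap R i₁ ⋙ SheafOfModules.overMap R j
  let G := SheafOfModules.overFunctor R U₁ ⋙ F
  let η (Y : SheafOfModules.{u} R) : (SheafOfModules.overMap R j).obj (Y.over U) ≅ G.obj Y :=
    (SheafOfModules.overMap R j).mapIso (e Y).symm
  have := hS.epi_g
  have hp' : IsColimit (CokernelCofork.ofπ (F.map p)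
      (show F.map f ≫ F.map p = 0 by rw [← F.map_comp, w, F.map_zero])) :=
    CokernelCofork.mapIsColimit _ hf.gIsCokernel F
  have hg' : IsColimit (CokernelCofork.ofπ (G.map S.g)
      (show G.map S.f ≫ G.map S.g = 0 by rw [← G.map_comp, S.zero, G.map_zero])) :=
    CokernelCofork.mapIsColimit _ hS.exact.gIsCokernel G
  let r := (overMapFreeIso j (ULift (Fin k))).hom ≫ (SheafOfModules.overMap R j).map q ≫
    (η S.X₁).hom
  have hr : l ≫ F.map p = r ≫ G.map S.f := by
    refine hl.trans ?_
    simp only [r, Category.assoc]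
    refine congr_arg ((overMapFreeIso j (ULift (Fin k))).hom ≫ ·) ?_
    refine ((SheafOfModules.overMap R j).map_comp _ _).trans ?_
    refine congr_arg ((SheafOfModules.overMap R j).map q ≫ ·) ?_
    refine Eq.trans ?_ ((SheafOfModules.overMap R j).map_comp _ _)
    exact congr_arg (SheafOfModules.overMap R j).map
      ((SheafOfModules.overFunctorMap R i₁).inv.naturality S.f)
  have w'' : coprod.desc (F.map f) l ≫ F.map p ≫ G.map S.g = 0 := by
    ext
    · rw [coprod.inl_desc_assoc, ← F.map_comp_assoc, w, F.map_zero, zero_comp, comp_zero]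
    · rw [coprod.inr_desc_assoc, reassoc_of% hr, ← G.map_comp, S.zero, G.map_zero, comp_zero,
        comp_zero]
  let T := ShortComplex.mk _ _ w''
  have hT := T.exact_and_epi_g_iff_g_is_cokernel.2
    ⟨CokernelCofork.isColimitDescComp hp' hg' r l hr w''⟩
  have := hT.2
  exact ⟨V, hxV, exists_presentation_of_iso T hT.1
    ((SheafOfModules.freeSumIso _ _).symm ≪≫ coprod.mapIso
      (overMapFreeIso j _ ≪≫ (SheafOfModules.overMap R j).mapIso (overMapFreeIso i₁ _))
      (Iso.refl _))
    (overMapFreeIso j _ ≪≫ (SheafOfModules.overMap R j).mapIso (overMapFreeIso i₁ _))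
    ((η S.X₃).symm ≪≫ (SheafOfModules.overFunctorMap R j).app S.X₃)⟩

end CoherentSheaves
end

section
/- Let 0 → M' → M → M'' → 0 be a short exact sequence of sheaves of A-modules. If M is locally finitely generated over A and M'' is locally finitely presented over A, then M' is locally finitely generated over A. -/
/-!
Finiteness conditions for sheaves of modules over a sheaf of rings on a
topological space `X`, following the paper. We use the Grothendieck topology
on `Opens X`; the restriction of a sheaf of modules to an open subset `U`
is given by `SheafOfModules.over`, and the further restriction of a sheaf of
`A|_U`-modules to a smaller open `V ≤ U` is given by pushforward to the
site `(J.over U).over V`.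
-/

universe u

open CategoryTheory Limits TopologicalSpace

universe v w

open Opposite

namespace CategoryTheory.ShortComplex

/-- If `S` is short exact, `p : P ⟶ S.X₂` is epi, and `K ⟶ Q ⟶ S.X₃` is exact, with `Q ⟶ S.X₃`
lifted through `S.g` and `p ≫ S.g` lifted through `Q ⟶ S.X₃`, then `S.X₁` is a quotient of
`P ⨿ K`. -/
lemma ShortExact.exists_epi_coprod {C : Type w} [Category.{v} C] [Abelian C]
    {S : ShortComplex C} (hS : S.ShortExact) {P Q K : C} (p : P ⟶ S.X₂) [Epi p]
    {f : K ⟶ Q} {q : Q ⟶ S.X₃} {w : f ≫ q = 0} (hf : (ShortComplex.mk f q w).Exact)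
    {t : Q ⟶ S.X₂} (ht : t ≫ S.g = q) {a : P ⟶ Q} (ha : a ≫ q = p ≫ S.g) :
    ∃ r : P ⨿ K ⟶ S.X₁, Epi r := by
  have := hS.mono_f
  let d : P ⟶ S.X₁ := hS.exact.lift (p - a ≫ t) (by simp [ht, ha])
  let e : K ⟶ S.X₁ := hS.exact.lift (f ≫ t) (by simp [ht, w])
  have hd : d ≫ S.f = p - a ≫ t := hS.exact.lift_f _ _
  have he : e ≫ S.f = f ≫ t := hS.exact.lift_f _ _
  refine ⟨coprod.desc d e, (epi_iff_surjective_up_to_refinements _).2 fun A y ↦ ?_⟩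
  obtain ⟨A₁, π₁, _, z, hz⟩ := surjective_up_to_refinements_of_epi p (y ≫ S.f)
  obtain ⟨A₂, π₂, _, b, hb⟩ := hf.exact_up_to_refinements (z ≫ a) (by
    simp [ha, ← reassoc_of% hz])
  refine ⟨A₂, π₂ ≫ π₁, inferInstance, (π₂ ≫ z) ≫ coprod.inl + b ≫ coprod.inr, ?_⟩
  dsimp at hb
  simp only [← cancel_mono S.f, Category.assoc, Preadditive.add_comp, coprod.inl_desc,
    coprod.inr_desc, hd, he, hz, Preadditive.comp_sub]
  simp [← reassoc_of% hb]

end CategoryTheory.ShortComplex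

lemma PresheafOfModules.isRightAdjoint_pushforward {C D : Type u} [SmallCategory C]
    [SmallCategory D] {F : C ⥤ D} {R : Dᵒᵖ ⥤ RingCat.{u}} {S : Cᵒᵖ ⥤ RingCat.{u}}
    (φ : S ⟶ F.op ⋙ R) : (PresheafOfModules.pushforward.{u} φ).IsRightAdjoint :=
  inferInstance

namespace SheafOfModules

section

variable {C : Type w} [Category.{v} C] {J : GrothendieckTopology C}
  {R : Sheaf J RingCat.{u}} [HasSheafify J AddCommGrpCat.{u}]
  [J.WEqualsLocallyBijective AddCommGrpCat.{u}]

/-- An epimorphism of sheaves of modules is locally surjective. -/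
lemma isLocallySurjective_of_epi {M N : SheafOfModules.{u} R} (g : M ⟶ N) [Epi g] :
    PresheafOfModules.IsLocallySurjective J g.val where
  imageSieve_mem {U} y := by
    let c := cokernel.π g.val
    let adj := PresheafOfModules.sheafificationAdjunction (𝟙 R.obj)
    let η := adj.unit.app (cokernel g.val)
    have hη : c ≫ η = 0 := by
      let k : N ⟶ (PresheafOfModules.sheafification (𝟙 R.obj)).obj (cokernel g.val) := ⟨c ≫ η⟩
      have hk : k = 0 := by
        rw [← cancel_epi g, comp_zero]
        ext1
        change g.val ≫ c ≫ η = 0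
        simp [c]
      exact congr_arg Hom.val hk
    have : Presheaf.IsLocallyInjective J ((PresheafOfModules.toPresheaf _).map η) := by
      rw [PresheafOfModules.toPresheaf_map_sheafificationAdjunction_unit_app]
      exact inferInstanceAs (Presheaf.IsLocallyInjective J
        (CategoryTheory.toSheafify J (cokernel g.val).presheaf))
    have hy : η.app (op U) (c.app (op U) y) = 0 :=
      congr_arg (fun φ : _ ⟶ _ ↦ PresheafOfModules.Hom.app φ (op U) y) hη
    have hmem := Presheaf.equalizerSieve_mem J ((PresheafOfModules.toPresheaf _).map η)
      (X := op U) (c.app (op U) y) 0 (hy.trans (map_zero (η.app (op U)).hom).symm)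
    refine J.superset_covering (fun V f hf ↦ ?_) hmem
    have hc : c.app (op V) (N.val.map f.op y) = 0 :=
      (PresheafOfModules.naturality_apply c f.op y).trans
        (hf.trans (map_zero ((cokernel g.val).presheaf.map f.op).hom))
    have hex : (ShortComplex.mk g.val c (by simp [c])).Exact :=
      ShortComplex.exact_cokernel g.val
    have := hex.map (PresheafOfModules.evaluation R.obj (op V))
    rw [ShortComplex.moduleCat_exact_iff] at this
    exact this (N.val.map f.op y) hc

end

section

variable {X : TopCat.{u}} {R : Sheaf (Opens.grothendieckTopology X) RingCat.{u}}

instance {U V : Opens X} (h : U ⟶ V) : (overMap.{u} R h).IsRightAdjoint := by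
  unfold overMap
  have := PresheafOfModules.isRightAdjoint_pushforward (C := Over U) (D := Over V)
    (F := Over.map h) (Sheaf.pushforwardOverMapIso R h).inv.hom
  infer_instance

instance (U : Opens X) : (overFunctor.{u} R U).IsRightAdjoint := by
  unfold overFunctor
  have := PresheafOfModules.isRightAdjoint_pushforward (C := Over U) (D := Opens X)
    (F := Over.forget U) (𝟙 (R.over U) : R.over U ⟶ _).hom
  infer_instance

instance (U : Opens X) : (overFunctor.{u} R U).IsLeftAdjoint :=
  inferInstanceAs (pushforward _).IsLeftAdjoint

/-- Restriction along `U ⟶ V` preserves free sheaves of modules. -/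
noncomputable def overMapFreeIso {U V : Opens X} (h : U ⟶ V) (I : Type u) :
    free (R := R.over U) I ≅ (overMap R h).obj (free I) :=
  mapFreeIso (overMap R h) I (overMapUnitIso h).symm

/-- Restricting `M` to `V` and then to `U ⟶ V` is the same as restricting `M` to `U`. -/
noncomputable def overMapOverIso {U V : Opens X} (h : U ⟶ V) (M : SheafOfModules.{u} R) :
    (overMap R h).obj (M.over V) ≅ M.over U :=
  (overFunctorMap R h).app M

/-- The restriction to `U` of a morphism from a free sheaf of modules to `M.over V`. -/
noncomputable def freeRestrict {U V : Opens X} (h : U ⟶ V) {M : SheafOfModules.{u} R} {I : Type u}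
    (q : free I ⟶ M.over V) : free I ⟶ M.over U :=
  (overMapFreeIso h I).hom ≫ (overMap R h).map q ≫ (overMapOverIso h M).hom

instance {U V : Opens X} (h : U ⟶ V) {M : SheafOfModules.{u} R} {I : Type u}
    (q : free I ⟶ M.over V) [Epi q] : Epi (freeRestrict h q) :=
  epi_comp' inferInstance (epi_comp' inferInstance inferInstance)

/-- Exact presentations restrict to smaller open subsets. -/
lemma exists_exact_freeRestrict {U V : Opens X} (h : U ⟶ V) {M : SheafOfModules.{u} R}
    {I J : Type u} {f : free I ⟶ free J} {q : free J ⟶ M.over V} {w : f ≫ q = 0}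
    (hfq : (ShortComplex.mk f q w).Exact) :
    ∃ (f' : free I ⟶ free J) (w' : f' ≫ freeRestrict h q = 0),
      (ShortComplex.mk f' (freeRestrict h q) w').Exact := by
  have w₀ : (overMap R h).map f ≫ (overMap R h).map q = 0 := by
    rw [← Functor.map_comp, w, Functor.map_zero]
  have w' : ((overMapFreeIso h I).hom ≫ (overMap R h).map f ≫ (overMapFreeIso h J).inv) ≫
      freeRestrict h q = 0 := by
    simp [freeRestrict, reassoc_of% w₀]
  refine ⟨_, w', (ShortComplex.exact_iff_of_iso (ShortComplex.isoMk
    (S₁ := (ShortComplex.mk f q w).map (overMap R h)) (S₂ := ShortComplex.mk _ _ w')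
    (overMapFreeIso h I).symm (overMapFreeIso h J).symm (overMapOverIso h M) ?_ ?_)).1
    (hfq.map (overMap R h))⟩
  · exact (Iso.inv_hom_id_assoc (overMapFreeIso h I)
      ((overMap R h).map f ≫ (overMapFreeIso h J).inv)).trans rfl
  · exact (Iso.inv_hom_id_assoc (overMapFreeIso h J)
      ((overMap R h).map q ≫ (overMapOverIso h M).hom)).trans rfl

/-- A section of `M.over V` on `W ≤ V` gives a global section of the restriction to `W`. -/
noncomputable def overMapSectionsMk {V W : Opens X} (h : W ⟶ V) {M : SheafOfModules.{u} (R.over V)}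
    (s : M.val.obj (op (Over.mk h))) : ((overMap R h).obj M).sections :=
  PresheafOfModules.sectionsMk
    (fun Z ↦ M.val.map (Over.homMk Z.unop.hom : (Over.map h).obj Z.unop ⟶ Over.mk h).op s)
    (fun Y Z f ↦ (PresheafOfModules.map_comp_apply M.val
      (Over.homMk Y.unop.hom : (Over.map h).obj Y.unop ⟶ Over.mk h).op
      ((Over.map h).map f.unop).op s).symm)

lemma freeHomEquiv_overMapFreeIso_hom_comp {U V : Opens X} (h : U ⟶ V) {I : Type u}
    {N : SheafOfModules.{u} (R.over V)} (φ : free I ⟶ N) (i : I) :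
    ((overMap R h).obj N).freeHomEquiv ((overMapFreeIso h I).hom ≫ (overMap R h).map φ) i =
      PresheafOfModules.sectionsMk (M := ((overMap R h).obj N).val)
        (fun Z ↦ (N.freeHomEquiv φ i).eval (op ((Over.map h).obj Z.unop)))
        (fun _ _ f ↦ (N.freeHomEquiv φ i).property ((Over.map h).map f.unop).op) := by
  change ((overMap R h).obj N).unitHomEquiv (ιFree i ≫ _ ≫ _) = _
  rw [overMapFreeIso, ιFree_mapFreeIso_hom_assoc, ← Functor.map_comp]
  rfl

/-- Sections lift locally through an epimorphism of sheaves of modules. -/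
lemma exists_local_lift {U : Opens X} {M N : SheafOfModules.{u} (R.over U)} (g : M ⟶ N) [Epi g]
    (s : N.sections) {x : X} (hx : x ∈ U) :
    ∃ (V : Opens X) (h : V ⟶ U), x ∈ V ∧
      ∃ t : M.val.obj (op (Over.mk h)), g.val.app _ t = s.eval _ := by
  have := isLocallySurjective_of_epi g
  have hs := Presheaf.imageSieve_mem ((Opens.grothendieckTopology X).over U)
    ((PresheafOfModules.toPresheaf _).map g.val) (s.eval (op (Over.mk (𝟙 U))))
  obtain ⟨V, f, hf, hV⟩ := hs x hx
  rw [Sieve.overEquiv_iff] at hf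
  obtain ⟨t, ht⟩ := hf
  exact ⟨V, f, hV, t, ht.trans (PresheafOfModules.sections_property s _)⟩

/-- Morphisms from a finite free sheaf of modules lift locally through an epimorphism. -/
lemma exists_local_lift_free {U : Opens X} {M N : SheafOfModules.{u} (R.over U)} (g : M ⟶ N)
    [Epi g] {I : Type u} [Finite I] (φ : free I ⟶ N) {x : X} (hx : x ∈ U) :
    ∃ V : Opens X, x ∈ V ∧ ∀ (W : Opens X) (h : W ⟶ U), W ≤ V →
      ∃ ψ : (overMap R h).obj (free I) ⟶ (overMap R h).obj M,
        ψ ≫ (overMap R h).map g = (overMap R h).map φ := by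
  choose V h hV t ht using fun i ↦ exists_local_lift g (N.freeHomEquiv φ i) hx
  refine ⟨⟨⋂ i, V i, isOpen_iInter_of_finite fun i ↦ (V i).isOpen⟩, by simpa using hV,
    fun W k hW ↦ ?_⟩
  have hWV (i : I) : W ≤ V i := hW.trans fun y hy ↦ Set.mem_iInter.1 hy i
  let t' (i : I) : M.val.obj (op (Over.mk k)) :=
    M.val.map (Over.homMk (homOfLE (hWV i)) : Over.mk k ⟶ Over.mk (h i)).op (t i)
  refine ⟨(overMapFreeIso k I).inv ≫
    (freeHomEquiv _).symm (fun i ↦ overMapSectionsMk k (t' i)), ?_⟩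
  rw [Category.assoc, Iso.inv_comp_eq, freeHomEquiv_symm_comp, Equiv.symm_apply_eq]
  ext i : 1
  rw [freeHomEquiv_overMapFreeIso_hom_comp]
  ext Z
  let a : (Over.map k).obj Z.unop ⟶ Over.mk k := Over.homMk Z.unop.hom
  let b : Over.mk k ⟶ Over.mk (h i) := Over.homMk (homOfLE (hWV i))
  have e : g.val.app (op ((Over.map k).obj Z.unop)) (M.val.map a.op (M.val.map b.op (t i))) =
      (N.freeHomEquiv φ i).eval (op ((Over.map k).obj Z.unop)) := by
    refine (PresheafOfModules.naturality_apply g.val a.op _).trans ?_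
    refine (congr_arg (N.val.map a.op) ((PresheafOfModules.naturality_apply g.val b.op _).trans
      (congr_arg (N.val.map b.op) (ht i)))).trans ?_
    exact (congr_arg (N.val.map a.op) (PresheafOfModules.sections_property _ b.op)).trans
      (PresheafOfModules.sections_property _ a.op)
  exact e

end

end SheafOfModules

namespace CoherentSheaves

variable {X : TopCat.{u}} {R : Sheaf (Opens.grothendieckTopology X) RingCat.{u}}

/-- In a short exact sequence, if `M` is locally finitely generated and `M''` is locally
finitely presented, then `M'` is locally finitely generated. -/
theorem isLFG_of_isLFG_isLFP (S : CategoryTheory.ShortComplex (SheafOfModules.{u} R)) (hS : S.ShortExact)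
    (hM : IsLFG S.X₂) (hM'' : IsLFP S.X₃) : IsLFG S.X₁ := by
  intro x
  obtain ⟨U₁, hxU₁, n₁, hn₁, p₁, _⟩ := hM x
  obtain ⟨U₂, hxU₂, m₂, n₂, _, _, f₂, q₂, w₂, _, hfq₂⟩ := hM'' x
  let U := U₁ ⊓ U₂
  let i₁ : U ⟶ U₁ := homOfLE inf_le_left
  let i₂ : U ⟶ U₂ := homOfLE inf_le_right
  have hxU : x ∈ U := ⟨hxU₁, hxU₂⟩
  let S' := S.map (SheafOfModules.overFunctor R U)
  have hS' : S'.ShortExact := hS.map_of_exact _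
  have := hS'.epi_g
  let p : SheafOfModules.free _ ⟶ S'.X₂ := SheafOfModules.freeRestrict i₁ p₁
  let q : SheafOfModules.free _ ⟶ S'.X₃ := SheafOfModules.freeRestrict i₂ q₂
  have : Epi p := inferInstanceAs (Epi (SheafOfModules.freeRestrict i₁ p₁))
  have : Epi q := inferInstanceAs (Epi (SheafOfModules.freeRestrict i₂ q₂))
  obtain ⟨f, w, hfq⟩ : ∃ (f : SheafOfModules.free (ULift.{u} (Fin m₂)) ⟶ _) (w : f ≫ q = 0),
      (ShortComplex.mk f q w).Exact := SheafOfModules.exists_exact_freeRestrict i₂ hfq₂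
  obtain ⟨V₁, hxV₁, h₁⟩ := SheafOfModules.exists_local_lift_free S'.g q hxU
  obtain ⟨V₂, hxV₂, h₂⟩ := SheafOfModules.exists_local_lift_free q (p ≫ S'.g) hxU
  let W := U ⊓ (V₁ ⊓ V₂)
  let k : W ⟶ U := homOfLE inf_le_left
  obtain ⟨t, ht⟩ := h₁ W k (inf_le_right.trans inf_le_left)
  obtain ⟨a, ha⟩ := h₂ W k (inf_le_right.trans inf_le_right)
  rw [Functor.map_comp] at ha
  let p' : _ ⟶ (S'.map (SheafOfModules.overMap R k)).X₂ := (SheafOfModules.overMap R k).map p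
  have : Epi p' := inferInstanceAs (Epi ((SheafOfModules.overMap R k).map p))
  obtain ⟨r, _⟩ : ∃ r : _ ⟶ (SheafOfModules.overMap R k).obj (S.X₁.over U), Epi r :=
    (hS'.map_of_exact (SheafOfModules.overMap R k)).exists_epi_coprod p'
      (hfq.map (SheafOfModules.overMap R k)) ht ha
  refine ⟨W, ⟨hxU, hxV₁, hxV₂⟩, n₁ + m₂, by omega, ?_⟩
  let e : ULift.{u} (Fin (n₁ + m₂)) ≃ ULift.{u} (Fin n₁) ⊕ ULift.{u} (Fin m₂) :=
    Equiv.ulift.trans (finSumFinEquiv.symm.trans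
      (Equiv.sumCongr Equiv.ulift.symm Equiv.ulift.symm))
  let I : SheafOfModules.free (ULift.{u} (Fin (n₁ + m₂))) ≅
      (SheafOfModules.overMap R k).obj (SheafOfModules.free (ULift.{u} (Fin n₁))) ⨿
        (SheafOfModules.overMap R k).obj (SheafOfModules.free (ULift.{u} (Fin m₂))) :=
    SheafOfModules.freeFunctor.mapIso e.toIso ≪≫ (SheafOfModules.freeSumIso _ _).symm ≪≫
      coprod.mapIso (SheafOfModules.overMapFreeIso k _) (SheafOfModules.overMapFreeIso k _)
  exact ⟨I.hom ≫ r ≫ (SheafOfModules.overMapOverIso k S.X₁).hom,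
    epi_comp' inferInstance (epi_comp' inferInstance inferInstance)⟩

end CoherentSheaves
end

section
/- Let 0 → M' → M → M'' → 0 be a short exact sequence of sheaves of A-modules. If M' and M'' are locally finitely presented over A, then M is locally finitely presented over A. -/
/-!
Finiteness conditions for sheaves of modules over a sheaf of rings on a
topological space `X`, following the paper. We use the Grothendieck topology
on `Opens X`; the restriction of a sheaf of modules to an open subset `U`
is given by `SheafOfModules.over`, and the further restriction of a sheaf of
`A|_U`-modules to a smaller open `V ≤ U` is given by pushforward to the
site `(J.over U).over V`.
-/

universe u

open CategoryTheory Limits TopologicalSpace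

namespace CoherentSheaves

variable {X : TopCat.{u}} {R : Sheaf (Opens.grothendieckTopology X) RingCat.{u}}

section Horseshoe

variable {C : Type*} [Category C] [Abelian C]

/-- An extension of presented objects is presented by the sum of the presentations, as soon as the
generators of the quotient lift to the extension, and the obstruction `t` to the relations of the
quotient lifts to the generators of the subobject. -/
lemma epi_and_exact_of_shortExact {S : ShortComplex C} (hS : S.ShortExact) {P' Q' P'' Q'' : C}
    {p' : P' ⟶ S.X₁} {r' : Q' ⟶ P'} {w' : r' ≫ p' = 0} (hp' : Epi p')
    (h' : (ShortComplex.mk r' p' w').Exact)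
    {p'' : P'' ⟶ S.X₃} {r'' : Q'' ⟶ P''} {w'' : r'' ≫ p'' = 0} (hp'' : Epi p'')
    (h'' : (ShortComplex.mk r'' p'' w'').Exact)
    {q : P'' ⟶ S.X₂} (hq : q ≫ S.g = p'') {t : Q'' ⟶ P'} (ht : t ≫ p' ≫ S.f = r'' ≫ q) :
    ∃ w : biprod.desc (r' ≫ biprod.inl) (biprod.lift (-t) r'') ≫ biprod.desc (p' ≫ S.f) q = 0,
      Epi (biprod.desc (p' ≫ S.f) q) ∧ (ShortComplex.mk _ _ w).Exact := by
  have := hS.mono_f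
  have w : biprod.desc (r' ≫ biprod.inl) (biprod.lift (-t) r'') ≫
      biprod.desc (p' ≫ S.f) q = 0 := by
    ext
    · simp [reassoc_of% w']
    · simp [ht]
  refine ⟨w, ?_, ?_⟩
  · rw [epi_iff_surjective_up_to_refinements]
    intro A y
    obtain ⟨A₁, π₁, _, b, hb⟩ := surjective_up_to_refinements_of_epi p'' (y ≫ S.g)
    obtain ⟨A₂, π₂, _, z, hz⟩ := hS.exact.exact_up_to_refinements (π₁ ≫ y - b ≫ q)
      (by simp [hq, hb])
    obtain ⟨A₃, π₃, _, a, ha⟩ := surjective_up_to_refinements_of_epi p' z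
    refine ⟨A₃, π₃ ≫ π₂ ≫ π₁, inferInstance, biprod.lift a (π₃ ≫ π₂ ≫ b), ?_⟩
    have := π₃ ≫= hz
    rw [reassoc_of% ha] at this
    simp only [Preadditive.comp_sub, sub_eq_iff_eq_add] at this
    simpa using this
  · rw [ShortComplex.exact_iff_exact_up_to_refinements]
    intro A y hy
    dsimp at y hy
    obtain ⟨a, b, rfl⟩ : ∃ a b, y = biprod.lift a b :=
      ⟨y ≫ biprod.fst, y ≫ biprod.snd, by ext <;> simp⟩
    rw [biprod.lift_desc] at hy
    have hb : b ≫ p'' = 0 := by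
      rw [← hq]
      simpa using hy =≫ S.g
    obtain ⟨A₁, π₁, _, c, hc⟩ := h''.exact_up_to_refinements b hb
    dsimp at c hc
    have ha : (π₁ ≫ a + c ≫ t) ≫ p' = 0 := by
      rw [← cancel_mono S.f]
      have := π₁ ≫= hy
      rw [Preadditive.comp_add, reassoc_of% hc, ← ht] at this
      simpa using this
    obtain ⟨A₂, π₂, _, d, hd⟩ := h'.exact_up_to_refinements _ ha
    dsimp at d hd
    refine ⟨A₂, π₂ ≫ π₁, inferInstance, biprod.lift d (π₂ ≫ c), ?_⟩
    dsimp
    ext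
    · simp [← hd]
    · simp [hc]

end Horseshoe

section SheafOfModules

variable {C : Type u} [SmallCategory C] {J : GrothendieckTopology C} {A : Sheaf J RingCat.{u}}

instance epi_toSheaf_map {M N : SheafOfModules.{u} A} (f : M ⟶ N) [Epi f] :
    Epi ((SheafOfModules.toSheaf A).map f) := by
  let adj := PresheafOfModules.sheafificationAdjunction.{u} (𝟙 A.obj)
  let G := PresheafOfModules.sheafification.{u} (𝟙 A.obj)
  let F := PresheafOfModules.toPresheaf.{u} A.obj ⋙ presheafToSheaf J AddCommGrpCat.{u}
  let e : G ⋙ SheafOfModules.toSheaf.{u} A ≅ F :=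
    PresheafOfModules.sheafificationCompToSheaf (𝟙 A.obj)
  let g := (SheafOfModules.forget A ⋙ PresheafOfModules.restrictScalars (𝟙 A.obj)).map f
  let i : Arrow.mk (G.map g) ≅ Arrow.mk f :=
    Arrow.isoMk (asIso (adj.counit.app M)) (asIso (adj.counit.app N)) (adj.counit.naturality f).symm
  have hG : Epi (G.map g) := ((MorphismProperty.epimorphisms _).arrow_mk_iso_iff i).2 ‹_›
  have hπ : F.map (cokernel.π g) = 0 := by
    have : G.map (cokernel.π g) = 0 := by
      rw [← cancel_epi (G.map g), ← G.map_comp, cokernel.condition]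
      simp
    have h := e.hom.naturality (cokernel.π g)
    rw [Functor.comp_map, this, Functor.map_zero, zero_comp] at h
    rw [← cancel_epi (e.hom.app _), ← h, comp_zero]
  have hF : Epi (F.map g) := by
    have h : (ShortComplex.mk g (cokernel.π g) (by simp)).Exact :=
      ShortComplex.exact_cokernel g
    exact (h.map_of_epi_of_preservesCokernel F inferInstance inferInstance).epi_f hπ
  have hFG : Epi ((SheafOfModules.toSheaf.{u} A).map (G.map g)) :=
    ((MorphismProperty.epimorphisms _).arrow_mk_iso_iff
      (Arrow.isoMk (e.app _) (e.app _) (e.hom.naturality g).symm)).2 hF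
  exact ((MorphismProperty.epimorphisms _).arrow_mk_iso_iff
    ((SheafOfModules.toSheaf.{u} A).mapArrow.mapIso i)).1 hFG

lemma mono_pushforward_map {D : Type u} [SmallCategory D] {K : GrothendieckTopology D} {F : D ⥤ C}
    [F.IsContinuous K J] {B : Sheaf K RingCat.{u}}
    (φ : B ⟶ (F.sheafPushforwardContinuous RingCat.{u} K J).obj A)
    {M N : SheafOfModules.{u} A} (f : M ⟶ N) [Mono f] :
    Mono ((SheafOfModules.pushforward φ).map f) := by
  have : Mono f.val := inferInstanceAs (Mono ((SheafOfModules.forget A).map f))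
  refine (SheafOfModules.forget B).mono_of_mono_map (PresheafOfModules.mono_of_injective ?_)
  intro X
  exact PresheafOfModules.injective_of_mono f.val (.op (F.obj X.unop))

/-- A pushforward functor which is a left adjoint is exact. -/
lemma shortExact_map_pushforward {D : Type u} [SmallCategory D] {K : GrothendieckTopology D}
    {F : D ⥤ C} [F.IsContinuous K J] {B : Sheaf K RingCat.{u}}
    (φ : B ⟶ (F.sheafPushforwardContinuous RingCat.{u} K J).obj A)
    [(SheafOfModules.pushforward.{u} φ).IsLeftAdjoint]
    {S : ShortComplex (SheafOfModules.{u} A)} (hS : S.ShortExact) :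
    (S.map (SheafOfModules.pushforward φ)).ShortExact := by
  have := hS.mono_f
  have := hS.epi_g
  exact
    { exact := hS.exact.map_of_epi_of_preservesCokernel _ inferInstance inferInstance
      mono_f := mono_pushforward_map φ S.f
      epi_g := inferInstanceAs (Epi ((SheafOfModules.pushforward φ).map S.g)) }

end SheafOfModules

section Restriction

variable {U V : Opens X}

lemma exists_app_eq_of_epi {M N : SheafOfModules.{u} (R.over U)} (e : M ⟶ N) [Epi e]
    {I : Type*} [Finite I] (b : I → N.sections) {x : X} (hx : x ∈ U) :
    ∃ (V : Opens X) (h : V ⟶ U), x ∈ V ∧ ∃ a : I → M.val.obj (.op (Over.mk h)),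
      ∀ i, e.val.app _ (a i) = (b i).val _ := by
  have := (Sheaf.isLocallySurjective_iff_epi' _ ((SheafOfModules.toSheaf _).map e)).2 inferInstance
  have key (i : I) : ∃ (V : Opens X) (h : V ⟶ U), x ∈ V ∧ ∃ a : M.val.obj (.op (Over.mk h)),
      e.val.app _ a = (b i).val _ := by
    have hi := Presheaf.imageSieve_mem ((Opens.grothendieckTopology X).over U)
      ((SheafOfModules.toSheaf _).map e).hom (U := .op (Over.mk (𝟙 U))) ((b i).val _)
    rw [GrothendieckTopology.mem_over_iff] at hi
    obtain ⟨V, h, hV, hxV⟩ := hi x hx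
    rw [Sieve.overEquiv_iff] at hV
    obtain ⟨a, ha⟩ := hV
    exact ⟨V, h, hxV, a, ha.trans ((b i).property _)⟩
  choose V h hxV a ha using key
  let W : Opens X := U ⊓ ⟨⋂ i, V i, isOpen_iInter_of_finite fun i ↦ (V i).isOpen⟩
  have hW (i : I) : W ≤ V i :=
    inf_le_right.trans (Set.iInter_subset (fun i ↦ (V i : Set X)) i)
  let k (i : I) : Over.mk (homOfLE inf_le_left : W ⟶ U) ⟶ Over.mk (h i) :=
    Over.homMk (homOfLE (hW i))
  refine ⟨W, homOfLE inf_le_left, ⟨hx, Set.mem_iInter.2 hxV⟩,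
    fun i ↦ M.val.map (k i).op (a i), fun i ↦ ?_⟩
  rw [PresheafOfModules.naturality_apply, ha, PresheafOfModules.sections_property]

/-- The section over `V ⟶ U` determined by an element of `M` over `V`. -/
noncomputable def overMapSection (M : SheafOfModules.{u} (R.over U)) (h : V ⟶ U)
    (a : M.val.obj (.op (Over.mk h))) : ((SheafOfModules.overMap R h).obj M).sections :=
  PresheafOfModules.sectionsMk
    (fun W ↦ M.val.map
      (Over.homMk W.unop.hom : (Over.map h).obj W.unop ⟶ Over.mk h).op a)
    (fun W₁ W₂ f ↦ (ConcreteCategory.congr_hom (M.val.presheaf.map_comp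
      (Over.homMk W₁.unop.hom : (Over.map h).obj W₁.unop ⟶ Over.mk h).op
      ((Over.map h).map f.unop).op) a).symm)

lemma exists_lift_overMap_of_epi {M N : SheafOfModules.{u} (R.over U)} (e : M ⟶ N) [Epi e]
    {I : Type u} [Finite I] (g : SheafOfModules.free I ⟶ N) {x : X} (hx : x ∈ U) :
    ∃ (V : Opens X) (h : V ⟶ U), x ∈ V ∧
      ∃ q : (SheafOfModules.overMap R h).obj (SheafOfModules.free I) ⟶
        (SheafOfModules.overMap R h).obj M,
      q ≫ (SheafOfModules.overMap R h).map e = (SheafOfModules.overMap R h).map g := by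
  obtain ⟨V, h, hxV, a, ha⟩ := exists_app_eq_of_epi e (N.freeHomEquiv g) hx
  let θ := SheafOfModules.mapFreeIso (SheafOfModules.overMap R h) I
    (SheafOfModules.overMapUnitIso h).symm
  refine ⟨V, h, hxV, θ.inv ≫ (SheafOfModules.freeHomEquiv _).symm
    fun i ↦ overMapSection M h (a i), ?_⟩
  rw [Category.assoc, Iso.inv_comp_eq, SheafOfModules.freeHomEquiv_symm_comp,
    Equiv.symm_apply_eq]
  ext i W
  have h₁ : SheafOfModules.ιFree i ≫ θ.hom ≫ (SheafOfModules.overMap R h).map g =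
      (SheafOfModules.overMapUnitIso h).inv ≫
        (SheafOfModules.overMap R h).map (SheafOfModules.ιFree i ≫ g) := by
    simp [θ]
  refine (PresheafOfModules.naturality_apply e.val
    (Over.homMk W.unop.hom : (Over.map h).obj W.unop ⟶ Over.mk h).op (a i)).trans ?_
  rw [ha, PresheafOfModules.sections_property]
  change _ = (SheafOfModules.ιFree i ≫ θ.hom ≫ (SheafOfModules.overMap R h).map g).val.app W _
  rw [h₁]
  rfl

end Restriction

section FinitePresentation

/-- A sheaf of modules is finite free if it is isomorphic to a free sheaf on a finite nonempty
type. -/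
def IsFiniteFree {C : Type u} [SmallCategory C] {J : GrothendieckTopology C}
    {A : Sheaf J RingCat.{u}} (P : SheafOfModules.{u} A) : Prop :=
  ∃ n : ℕ, 0 < n ∧ Nonempty (P ≅ SheafOfModules.free (ULift.{u} (Fin n)))

variable {C : Type u} [SmallCategory C] {J : GrothendieckTopology C} {A : Sheaf J RingCat.{u}}

lemma IsFiniteFree.biprod {P Q : SheafOfModules.{u} A} (hP : IsFiniteFree P) (hQ : IsFiniteFree Q) :
    IsFiniteFree (P ⊞ Q) := by
  obtain ⟨m, hm, ⟨eP⟩⟩ := hP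
  obtain ⟨n, hn, ⟨eQ⟩⟩ := hQ
  refine ⟨m + n, by omega, ⟨biprod.mapIso eP eQ ≪≫ biprod.isoCoprod _ _ ≪≫
    SheafOfModules.freeSumIso _ _ ≪≫ SheafOfModules.freeFunctor.mapIso (Equiv.toIso ?_)⟩⟩
  exact (Equiv.sumCongr Equiv.ulift Equiv.ulift).trans (finSumFinEquiv.trans Equiv.ulift.symm)

lemma IsFiniteFree.overMap {U V : Opens X} {P : SheafOfModules.{u} (R.over U)} (hP : IsFiniteFree P)
    (h : V ⟶ U) : IsFiniteFree ((SheafOfModules.overMap R h).obj P) := by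
  obtain ⟨n, hn, ⟨e⟩⟩ := hP
  exact ⟨n, hn, ⟨(SheafOfModules.overMap R h).mapIso e ≪≫
    (SheafOfModules.mapFreeIso (SheafOfModules.overMap R h) _
      (SheafOfModules.overMapUnitIso h).symm).symm⟩⟩

/-- A finite presentation of a sheaf of modules. -/
structure FinitePresentation (M : SheafOfModules.{u} A) where
  Q : SheafOfModules.{u} A
  P : SheafOfModules.{u} A
  f : Q ⟶ P
  p : P ⟶ M
  w : f ≫ p = 0
  isFiniteFree_Q : IsFiniteFree Q
  isFiniteFree_P : IsFiniteFree P
  epi_p : Epi p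
  exact : (ShortComplex.mk f p w).Exact

attribute [instance] FinitePresentation.epi_p

/-- Transport of a finite presentation along an isomorphism. -/
def FinitePresentation.ofIso {M N : SheafOfModules.{u} A} (σ : FinitePresentation M) (e : M ≅ N) :
    FinitePresentation N where
  Q := σ.Q
  P := σ.P
  f := σ.f
  p := σ.p ≫ e.hom
  w := by simp [reassoc_of% σ.w]
  isFiniteFree_Q := σ.isFiniteFree_Q
  isFiniteFree_P := σ.isFiniteFree_P
  epi_p := inferInstance
  exact := by
    have w : σ.f ≫ σ.p ≫ e.hom = 0 := by simp [reassoc_of% σ.w]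
    let i : ShortComplex.mk _ _ σ.w ≅ ShortComplex.mk _ _ w :=
      ShortComplex.isoMk (Iso.refl _) (Iso.refl _) e (by simp) (by simp)
    exact (ShortComplex.exact_iff_of_iso i).1 σ.exact

instance inst_s8 (U : Opens X) : (SheafOfModules.overFunctor.{u} R U).IsLeftAdjoint := by
  unfold SheafOfModules.overFunctor; infer_instance

/-- Restriction of a finite presentation to a smaller open subset. -/
noncomputable def FinitePresentation.overMap {U V : Opens X} {M : SheafOfModules.{u} (R.over U)}
    (σ : FinitePresentation M) (h : V ⟶ U) :
    FinitePresentation ((SheafOfModules.overMap R h).obj M) where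
  Q := (SheafOfModules.overMap R h).obj σ.Q
  P := (SheafOfModules.overMap R h).obj σ.P
  f := (SheafOfModules.overMap R h).map σ.f
  p := (SheafOfModules.overMap R h).map σ.p
  w := by rw [← Functor.map_comp, σ.w, Functor.map_zero]
  isFiniteFree_Q := σ.isFiniteFree_Q.overMap h
  isFiniteFree_P := σ.isFiniteFree_P.overMap h
  epi_p := inferInstance
  exact := σ.exact.map_of_epi_of_preservesCokernel _ σ.epi_p inferInstance

lemma isLFP_iff (M : SheafOfModules.{u} R) :
    IsLFP M ↔ ∀ x : X, ∃ U : Opens X, x ∈ U ∧ Nonempty (FinitePresentation (M.over U)) := by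
  refine forall_congr' fun x ↦ exists_congr fun U ↦ and_congr_right fun hx ↦ ⟨?_, ?_⟩
  · rintro ⟨m, n, hm, hn, f, p, w, hp, h⟩
    exact ⟨_, _, f, p, w, ⟨m, hm, ⟨Iso.refl _⟩⟩, ⟨n, hn, ⟨Iso.refl _⟩⟩, hp, h⟩
  · rintro ⟨Q, P, f, p, w, ⟨m, hm, ⟨eQ⟩⟩, ⟨n, hn, ⟨eP⟩⟩, hp, h⟩
    have w' : (eQ.inv ≫ f ≫ eP.hom) ≫ eP.inv ≫ p = 0 := by simp [w]
    let i : ShortComplex.mk _ _ w ≅ ShortComplex.mk _ _ w' :=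
      ShortComplex.isoMk eQ eP (Iso.refl _) (by simp) (by simp)
    exact ⟨m, n, hm, hn, _, _, w', inferInstance, (ShortComplex.exact_iff_of_iso i).1 h⟩

lemma IsFiniteFree.exists_lift_overMap_of_epi {U : Opens X}
    {P M N : SheafOfModules.{u} (R.over U)} (hP : IsFiniteFree P) (e : M ⟶ N) [Epi e]
    (g : P ⟶ N) {x : X} (hx : x ∈ U) :
    ∃ (V : Opens X) (h : V ⟶ U), x ∈ V ∧
      ∃ q : (SheafOfModules.overMap R h).obj P ⟶ (SheafOfModules.overMap R h).obj M,
      q ≫ (SheafOfModules.overMap R h).map e = (SheafOfModules.overMap R h).map g := by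
  obtain ⟨n, -, ⟨i⟩⟩ := hP
  obtain ⟨V, h, hxV, q, hq⟩ := CoherentSheaves.exists_lift_overMap_of_epi e (i.inv ≫ g) hx
  refine ⟨V, h, hxV, (SheafOfModules.overMap R h).map i.hom ≫ q, ?_⟩
  rw [Category.assoc, hq, ← Functor.map_comp, i.hom_inv_id_assoc]

lemma exists_finitePresentation_over {S : ShortComplex (SheafOfModules.{u} R)} (hS : S.ShortExact)
    {U : Opens X} (σ' : FinitePresentation (S.X₁.over U)) (σ'' : FinitePresentation (S.X₃.over U))
    {x : X} (hx : x ∈ U) :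
    ∃ V : Opens X, x ∈ V ∧ Nonempty (FinitePresentation (S.X₂.over V)) := by
  let E := SheafOfModules.overFunctor R U
  have hT : (S.map E).ShortExact := shortExact_map_pushforward _ hS
  have : Epi (E.map S.g) := hT.epi_g
  obtain ⟨V, h, hxV, q, hq⟩ :=
    σ''.isFiniteFree_P.exists_lift_overMap_of_epi (E.map S.g) σ''.p hx
  let F := SheafOfModules.overMap R h
  have hS₁ : ((S.map E).map F).ShortExact := shortExact_map_pushforward _ hT
  have := hS₁.mono_f
  let s : F.obj σ''.Q ⟶ F.obj (E.obj S.X₁) := hS₁.exact.lift (F.map σ''.f ≫ q) (by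
    change (F.map σ''.f ≫ q) ≫ F.map (E.map S.g) = 0
    rw [Category.assoc, hq, ← Functor.map_comp, σ''.w, Functor.map_zero])
  have hs : s ≫ F.map (E.map S.f) = F.map σ''.f ≫ q := hS₁.exact.lift_f _ _
  obtain ⟨W, k, hxW, t, ht⟩ :=
    (σ''.isFiniteFree_Q.overMap h).exists_lift_overMap_of_epi (F.map σ'.p) s hxV
  let G := SheafOfModules.overMap R k
  let τ' := (σ'.overMap h).overMap k
  let τ'' := (σ''.overMap h).overMap k
  have hS₂ : (((S.map E).map F).map G).ShortExact := shortExact_map_pushforward _ hS₁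
  obtain ⟨w, hepi, hexact⟩ := epi_and_exact_of_shortExact hS₂
    (p' := τ'.p) (r' := τ'.f) τ'.epi_p τ'.exact (p'' := τ''.p) (r'' := τ''.f) τ''.epi_p τ''.exact
    (q := G.map q) (t := t)
    (by
      change G.map q ≫ G.map (F.map (E.map S.g)) = G.map (F.map σ''.p)
      rw [← Functor.map_comp, hq])
    (by
      change t ≫ G.map (F.map σ'.p) ≫ G.map (F.map (E.map S.f)) = G.map (F.map σ''.f) ≫ G.map q
      rw [reassoc_of% ht, ← Functor.map_comp, hs, Functor.map_comp])
  let τ : FinitePresentation (G.obj (F.obj (E.obj S.X₂))) :=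
    { Q := _
      P := _
      f := _
      p := _
      w := w
      isFiniteFree_Q := τ'.isFiniteFree_Q.biprod τ''.isFiniteFree_Q
      isFiniteFree_P := τ'.isFiniteFree_P.biprod τ''.isFiniteFree_P
      epi_p := hepi
      exact := hexact }
  exact ⟨W, hxW, ⟨τ.ofIso (G.mapIso ((SheafOfModules.overFunctorMap R h).app S.X₂) ≪≫
    (SheafOfModules.overFunctorMap R k).app S.X₂)⟩⟩

end FinitePresentation

/-- In a short exact sequence, if `M'` and `M''` are locally finitely presented, then so
is `M`. -/
theorem isLFP_of_isLFP_isLFP (S : CategoryTheory.ShortComplex (SheafOfModules.{u} R)) (hS : S.ShortExact)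
    (hM' : IsLFP S.X₁) (hM'' : IsLFP S.X₃) : IsLFP S.X₂ := by
  rw [isLFP_iff] at hM' hM'' ⊢
  intro x
  obtain ⟨U', hx', ⟨σ'⟩⟩ := hM' x
  obtain ⟨U'', hx'', ⟨σ''⟩⟩ := hM'' x
  let i' : U' ⊓ U'' ⟶ U' := homOfLE inf_le_left
  let i'' : U' ⊓ U'' ⟶ U'' := homOfLE inf_le_right
  exact exists_finitePresentation_over hS
    ((σ'.overMap i').ofIso ((SheafOfModules.overFunctorMap R i').app _))
    ((σ''.overMap i'').ofIso ((SheafOfModules.overFunctorMap R i'').app _)) ⟨hx', hx''⟩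

end CoherentSheaves
end

section
/- Let 0 → M' → M → M'' → 0 be a short exact sequence of sheaves of A-modules. If M' and M'' are coherent over A, then M is coherent over A. -/
/-!
Finiteness conditions for sheaves of modules over a sheaf of rings on a
topological space `X`, following the paper. We use the Grothendieck topology
on `Opens X`; the restriction of a sheaf of modules to an open subset `U`
is given by `SheafOfModules.over`, and the further restriction of a sheaf of
`A|_U`-modules to a smaller open `V ≤ U` is given by pushforward to the
site `(J.over U).over V`.
-/

universe u

open CategoryTheory Limits TopologicalSpace

namespace CoherentSheaves

variable {X : TopCat.{u}} {R : Sheaf (Opens.grothendieckTopology X) RingCat.{u}}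

universe v' u'

open Opposite

section Site

variable {C : Type u'} [Category.{v'} C] {J : GrothendieckTopology C}
  {R : Sheaf J RingCat.{u}}

/-- The sections of a sheaf of modules over an object of the site. -/
abbrev Sec (M : SheafOfModules.{u} R) (Y : C) : Type u := M.val.obj (op Y)

/-- The sections of a sheaf of rings over an object of the site. -/
abbrev Coef (R : Sheaf J RingCat.{u}) (Y : C) : Type u := R.obj.obj (op Y)

/-- Restriction of sections of a sheaf of rings. -/
abbrev resR (R : Sheaf J RingCat.{u}) {Y Z : C} (f : Z ⟶ Y) : Coef R Y →+* Coef R Z :=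
  (R.obj.map f.op).hom

/-- Restriction of sections of a sheaf of modules. -/
noncomputable abbrev res (M : SheafOfModules.{u} R) {Y Z : C} (f : Z ⟶ Y) :
    Sec M Y →ₛₗ[resR R f] Sec M Z :=
  M.val.restrictₛₗ f.op

/-- The map induced on sections by a morphism of sheaves of modules. -/
abbrev appSec {M N : SheafOfModules.{u} R} (φ : M ⟶ N) (Y : C) : Sec M Y →ₗ[Coef R Y] Sec N Y :=
  (φ.val.app (op Y)).hom

lemma resR_comp {X Y Z : C} (g : Z ⟶ Y) (f : Y ⟶ X) (a : Coef R X) :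
    resR R (g ≫ f) a = resR R g (resR R f a) := by
  simp [resR]

lemma res_comp (M : SheafOfModules.{u} R) {X Y Z : C} (g : Z ⟶ Y) (f : Y ⟶ X) (s : Sec M X) :
    res M (g ≫ f) s = res M g (res M f s) :=
  M.val.map_comp_apply f.op g.op s

lemma res_assoc (M : SheafOfModules.{u} R) {W X Y Z : C} (h : Z ⟶ Y) (g : Y ⟶ X) (f : X ⟶ W)
    (s : Sec M W) : res M ((h ≫ g) ≫ f) s = res M (h ≫ g ≫ f) s := by
  rw [Category.assoc]

lemma appSec_res {M N : SheafOfModules.{u} R} (φ : M ⟶ N) {Y Z : C} (f : Z ⟶ Y) (s : Sec M Y) :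
    appSec φ Z (res M f s) = res N f (appSec φ Y s) :=
  PresheafOfModules.naturality_apply φ.val f.op s

section Relations

/-- The linear combination of a finite family of sections. -/
noncomputable abbrev lc {I : Type*} [Fintype I] {N : SheafOfModules.{u} R} {Y : C}
    (s : I → Sec N Y) : (I → Coef R Y) →ₗ[Coef R Y] Sec N Y :=
  Fintype.linearCombination (Coef R Y) s

/-- The linear combination of a finite family of rows of coefficients. -/
abbrev lcRow {I K : Type*} [Fintype K] {Y : C} (r : K → I → Coef R Y) :
    (K → Coef R Y) →ₗ[Coef R Y] (I → Coef R Y) :=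
  Fintype.linearCombination (Coef R Y) r

/-- Restriction of a row of coefficients. -/
abbrev resRow (R : Sheaf J RingCat.{u}) {I : Type*} {Y Z : C} (f : Z ⟶ Y) (a : I → Coef R Y) :
    I → Coef R Z := fun i => resR R f (a i)

lemma lc_lcRow {I K : Type*} [Fintype I] [Fintype K] {N : SheafOfModules.{u} R} {Y : C}
    (s : I → Sec N Y) (r : K → I → Coef R Y) (d : K → Coef R Y) :
    lc s (lcRow r d) = lc (fun k => lc s (r k)) d := by
  simp only [Fintype.linearCombination_apply _ _ d, map_sum, map_smul]

lemma lcRow_lcRow {I K L : Type*} [Fintype L] [Fintype K] {Y : C}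
    (r : K → I → Coef R Y) (e : L → K → Coef R Y) (d : L → Coef R Y) :
    lcRow r (lcRow e d) = lcRow (fun l => lcRow r (e l)) d := by
  simp only [Fintype.linearCombination_apply _ _ d, map_sum, map_smul]

lemma res_lc {I : Type*} [Fintype I] (N : SheafOfModules.{u} R) {Y Z : C} (f : Z ⟶ Y)
    (s : I → Sec N Y) (a : I → Coef R Y) :
    res N f (lc s a) = lc (fun i => res N f (s i)) (resRow R f a) := by
  simp only [Fintype.linearCombination_apply, map_sum, map_smulₛₗ]

lemma resRow_lcRow {I K : Type*} [Fintype K] {Y Z : C} (f : Z ⟶ Y)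
    (r : K → I → Coef R Y) (d : K → Coef R Y) :
    resRow R f (lcRow r d) = lcRow (fun k => resRow R f (r k)) (resRow R f d) := by
  ext i
  simp [resRow, Fintype.linearCombination_apply]

lemma resRow_comp {I : Type*} {X Y Z : C} (g : Z ⟶ Y) (f : Y ⟶ X) (a : I → Coef R X) :
    resRow R (g ≫ f) a = resRow R g (resRow R f a) :=
  funext fun i => resR_comp g f (a i)

lemma appSec_lc {I : Type*} [Fintype I] {M N : SheafOfModules.{u} R} (φ : M ⟶ N) {Y : C}
    (s : I → Sec M Y) (a : I → Coef R Y) :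
    appSec φ Y (lc s a) = lc (fun i => appSec φ Y (s i)) a := by
  simp only [Fintype.linearCombination_apply, map_sum, map_smul]

variable {P : Type*} (pt : C → Set P)

/-- The finite family of sections `s` of `N` over `W` generates `N` locally over `W`. -/
def Gen {I : Type*} [Fintype I] {N : SheafOfModules.{u} R} {W : C} (s : I → Sec N W) : Prop :=
  ∀ (Y : C) (f : Y ⟶ W) (t : Sec N Y), ∀ y ∈ pt Y, ∃ (Z : C) (g : Z ⟶ Y), y ∈ pt Z ∧
    ∃ a : I → Coef R Z, lc (fun i => res N (g ≫ f) (s i)) a = res N g t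

/-- The finite family of rows `r` over `W` consists of relations between the sections `s` and
generates all relations between them locally over `W`. -/
def RelGen {I K : Type*} [Fintype I] [Fintype K] {N : SheafOfModules.{u} R} {W : C}
    (s : I → Sec N W) (r : K → I → Coef R W) : Prop :=
  (∀ k, lc s (r k) = 0) ∧
    ∀ (Y : C) (f : Y ⟶ W) (a : I → Coef R Y), lc (fun i => res N f (s i)) a = 0 →
      ∀ y ∈ pt Y, ∃ (Z : C) (g : Z ⟶ Y), y ∈ pt Z ∧
        ∃ d : K → Coef R Z, lcRow (fun k => resRow R (g ≫ f) (r k)) d = resRow R g a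

variable {pt}

lemma Gen.res {I : Type*} [Fintype I] {N : SheafOfModules.{u} R} {W V : C} {s : I → Sec N W}
    (hs : Gen pt s) (h : V ⟶ W) : Gen pt fun i => res N h (s i) := by
  intro Y f t y hy
  obtain ⟨Z, g, hZ, a, ha⟩ := hs Y (f ≫ h) t y hy
  refine ⟨Z, g, hZ, a, ?_⟩
  simpa only [← res_comp, res_assoc] using ha

lemma RelGen.res {I K : Type*} [Fintype I] [Fintype K] {N : SheafOfModules.{u} R} {W V : C}
    {s : I → Sec N W} {r : K → I → Coef R W} (hr : RelGen pt s r) (h : V ⟶ W) :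
    RelGen pt (fun i => res N h (s i)) fun k => resRow R h (r k) := by
  refine ⟨fun k => ?_, fun Y f a ha y hy => ?_⟩
  · rw [← res_lc, hr.1 k, map_zero]
  · obtain ⟨Z, g, hZ, d, hd⟩ := hr.2 Y (f ≫ h) a (by simpa only [← res_comp] using ha) y hy
    refine ⟨Z, g, hZ, d, ?_⟩
    simpa only [← resRow_comp, ← Category.assoc] using hd

lemma exists_forall_of_finite {L : Type*} [Finite L] {W : C} {y : P} (hy : y ∈ pt W)
    (Q : L → ∀ Z : C, (Z ⟶ W) → Prop)
    (hQ : ∀ l (Z Z' : C) (f : Z ⟶ W) (g : Z' ⟶ Z), Q l Z f → Q l Z' (g ≫ f))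
    (h : ∀ l (Z : C) (f : Z ⟶ W), y ∈ pt Z → ∃ (Z' : C) (g : Z' ⟶ Z), y ∈ pt Z' ∧ Q l Z' (g ≫ f)) :
    ∃ (Z : C) (f : Z ⟶ W), y ∈ pt Z ∧ ∀ l, Q l Z f := by
  classical
  have := Fintype.ofFinite L
  suffices H : ∀ T : Finset L, ∃ (Z : C) (f : Z ⟶ W), y ∈ pt Z ∧ ∀ l ∈ T, Q l Z f by
    obtain ⟨Z, f, hZ, hf⟩ := H Finset.univ
    exact ⟨Z, f, hZ, fun l => hf l (Finset.mem_univ l)⟩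
  intro T
  induction T using Finset.induction_on with
  | empty => exact ⟨W, 𝟙 W, hy, by simp⟩
  | insert l T _ ih =>
    obtain ⟨Z, f, hZ, hf⟩ := ih
    obtain ⟨Z', g, hZ', hg⟩ := h l Z f hZ
    refine ⟨Z', g ≫ f, hZ', fun m hm => ?_⟩
    obtain rfl | hm := Finset.mem_insert.1 hm
    · exact hg
    · exact hQ m _ _ f g (hf m hm)

lemma Gen.exists_family {I L : Type*} [Fintype I] [Finite L] {N : SheafOfModules.{u} R} {W : C}
    {s : I → Sec N W} (hs : Gen pt s) (t : L → Sec N W) {y : P} (hy : y ∈ pt W) :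
    ∃ (Z : C) (g : Z ⟶ W), y ∈ pt Z ∧ ∃ a : L → I → Coef R Z,
      ∀ l, lc (fun i => CoherentSheaves.res N g (s i)) (a l) = CoherentSheaves.res N g (t l) := by
  obtain ⟨Z, g, hZ, h⟩ := exists_forall_of_finite hy
    (fun l Z g => ∃ a : I → Coef R Z,
      lc (fun i => CoherentSheaves.res N g (s i)) a = CoherentSheaves.res N g (t l))
    (by
      rintro l Z Z' f g ⟨a, ha⟩
      refine ⟨resRow R g a, ?_⟩
      simp only [res_comp N g f, ← res_lc, ha])
    (by
      intro l Z f hZ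
      obtain ⟨Z', g, hZ', a, ha⟩ := hs Z f (CoherentSheaves.res N f (t l)) y hZ
      exact ⟨Z', g, hZ', a, by rw [ha, res_comp]⟩)
  choose a ha using h
  exact ⟨Z, g, hZ, a, ha⟩

/-- Relations between a family of sections obtained by comparison with another family. -/
lemma RelGen.comparison {I K L : Type*} [Fintype I] [Fintype K] [Fintype L] [DecidableEq I]
    {N : SheafOfModules.{u} R} {W : C} {t : K → Sec N W} {r : L → K → Coef R W}
    (hr : RelGen pt t r) {s : I → Sec N W} {a : I → K → Coef R W} (ha : ∀ i, lc t (a i) = s i)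
    {b : K → I → Coef R W} (hb : ∀ k, lc s (b k) = t k) :
    RelGen pt s
      (Sum.elim (fun i => Pi.single i 1 - lcRow b (a i)) (fun l => lcRow b (r l))) := by
  obtain rfl : (fun k => lc s (b k)) = t := funext hb
  refine ⟨?_, fun Y f c hc y hy => ?_⟩
  · rintro (i | l)
    · simp only [Sum.elim_inl]
      rw [map_sub, lc_lcRow, ha, Fintype.linearCombination_apply_single, one_smul, sub_self]
    · simp only [Sum.elim_inr]
      rw [lc_lcRow, hr.1]
  · obtain ⟨Z, g, hZ, d, hd⟩ := hr.2 Y f (lcRow (fun i => resRow R f (a i)) c) (by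
      rw [lc_lcRow, ← hc]
      congr 1
      simp only [← res_lc, ha]) y hy
    refine ⟨Z, g, hZ, Sum.elim (resRow R g c) d, ?_⟩
    have h1 (i : I) : resRow R (g ≫ f) (Pi.single i (1 : Coef R W)) = Pi.single i 1 := by
      ext j
      by_cases hij : j = i
      · subst hij; simp [resRow]
      · simp [resRow, hij]
    have h2 : lcRow (fun i => resRow R (g ≫ f) (a i)) (resRow R g c) =
        lcRow (fun l => resRow R (g ≫ f) (r l)) d := by
      rw [hd, resRow_lcRow]
      simp only [resRow_comp]
    have h3 (e e' : I → Coef R W) : resRow R (g ≫ f) (e - e') =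
        resRow R (g ≫ f) e - resRow R (g ≫ f) e' := funext fun i => map_sub _ _ _
    rw [Fintype.linearCombination_apply, Fintype.sum_sum_type]
    simp only [Sum.elim_inl, Sum.elim_inr, h3, h1, smul_sub, Finset.sum_sub_distrib,
      resRow_lcRow]
    rw [← Fintype.linearCombination_apply (R := Coef R Z), ← Fintype.linearCombination_apply,
      ← Fintype.linearCombination_apply,
      ← lcRow_lcRow, ← lcRow_lcRow, h2, sub_add_cancel]
    ext i
    simp [Fintype.linearCombination_apply, Pi.single_apply]

/-- Sections locally generated by finitely many of them. -/
def LFGs (pt : C → Set P) (N : SheafOfModules.{u} R) : Prop :=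
  ∀ (W : C), ∀ x ∈ pt W, ∃ (V : C) (_ : V ⟶ W), x ∈ pt V ∧
    ∃ (I : Type) (_ : Fintype I) (_ : Nonempty I) (s : I → Sec N V), Gen pt s

/-- Sections locally generated by finitely many of them, with finitely many relations. -/
def LFPs (pt : C → Set P) (N : SheafOfModules.{u} R) : Prop :=
  ∀ (W : C), ∀ x ∈ pt W, ∃ (V : C) (_ : V ⟶ W), x ∈ pt V ∧
    ∃ (I : Type) (_ : Fintype I) (_ : Nonempty I) (s : I → Sec N V)
      (K : Type) (_ : Fintype K) (_ : Nonempty K) (r : K → I → Coef R V),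
      Gen pt s ∧ RelGen pt s r

/-- In a locally finitely presented sheaf of modules, the relations between any finite family
of generators are locally finitely generated. -/
lemma LFPs.exists_relGen {N : SheafOfModules.{u} R} (hN : LFPs pt N) {W : C} {x : P}
    (hx : x ∈ pt W) {I : Type} [Fintype I] [Nonempty I] {s : I → Sec N W} (hs : Gen pt s) :
    ∃ (V : C) (h : V ⟶ W), x ∈ pt V ∧
      ∃ (K : Type) (_ : Fintype K) (_ : Nonempty K) (r : K → I → Coef R V),
        RelGen pt (fun i => CoherentSheaves.res N h (s i)) r := by
  classical
  obtain ⟨V, h, hV, L, _, _, t, K, _, _, r, ht, hr⟩ := hN W x hx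
  obtain ⟨V₁, h₁, hV₁, a, ha⟩ := ht.exists_family (fun i => CoherentSheaves.res N h (s i)) hV
  obtain ⟨V₂, h₂, hV₂, b, hb⟩ := (hs.res (h₁ ≫ h)).exists_family
    (fun l => CoherentSheaves.res N h₁ (t l)) hV₁
  refine ⟨V₂, h₂ ≫ h₁ ≫ h, hV₂, I ⊕ K, inferInstance, inferInstance, _,
    RelGen.comparison (t := fun l => CoherentSheaves.res N (h₂ ≫ h₁) (t l))
      (hr.res (h₂ ≫ h₁)) (a := fun i => resRow R h₂ (a i)) (b := b) (fun i => ?_) (fun l => ?_)⟩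
  · simp only [res_comp, ← res_lc, ha]
  · simp only [res_comp] at hb ⊢
    exact hb l

/-- Generators of an extension obtained from generators of the kernel and lifts of generators of
the quotient. -/
lemma Gen.of_shortExact {N' N N'' : SheafOfModules.{u} R} {i : N' ⟶ N} {q : N ⟶ N''}
    (hexact : ∀ (Y : C) (s : Sec N Y), appSec q Y s = 0 → ∃ t, appSec i Y t = s)
    {W : C} {I K : Type*} [Fintype I] [Fintype K] {r : I → Sec N' W} (hr : Gen pt r)
    {s : K → Sec N W} (hs : Gen pt fun k => appSec q W (s k)) :
    Gen pt (Sum.elim (fun j => appSec i W (r j)) s) := by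
  intro Y f t y hy
  obtain ⟨Z, g, hZ, a, ha⟩ := hs Y f (appSec q Y t) y hy
  obtain ⟨b, hb⟩ := hexact Z (CoherentSheaves.res N g t -
      lc (fun k => CoherentSheaves.res N (g ≫ f) (s k)) a) (by
    rw [map_sub, appSec_lc, sub_eq_zero]
    simp only [appSec_res]
    exact ha.symm)
  obtain ⟨Z', g', hZ', c, hc⟩ := hr Z (g ≫ f) b y hZ
  refine ⟨Z', g' ≫ g, hZ', Sum.elim c (resRow R g' a), ?_⟩
  have h := congr(appSec i Z' $hc)
  rw [appSec_lc, appSec_res, hb, map_sub, res_lc, eq_sub_iff_add_eq] at h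
  rw [res_comp, ← h, Fintype.linearCombination_apply, Fintype.sum_sum_type]
  simp only [Sum.elim_inl, Sum.elim_inr, Fintype.linearCombination_apply, appSec_res, ← res_comp,
    res_assoc]

section Extension

variable {N' N N'' : SheafOfModules.{u} R} {i : N' ⟶ N} {q : N ⟶ N''}
  (hi : ∀ Y, Function.Injective (appSec i Y)) (hiq : i ≫ q = 0)
  (hexact : ∀ (Y : C) (s : Sec N Y), appSec q Y s = 0 → ∃ t, appSec i Y t = s)

include hi in
lemma Gen.of_relGen {W : C} {I K : Type} [Fintype I] [Fintype K]
    {s : I → Sec N W} (hs : Gen pt s) {r : K → I → Coef R W}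
    (hr : RelGen pt (fun j => appSec q W (s j)) r) (hiq : i ≫ q = 0)
    {n : K → Sec N' W} (hn : ∀ k, appSec i W (n k) = lc s (r k)) : Gen pt n := by
  intro Y f t y hy
  obtain ⟨Z, g, hZ, a, ha⟩ := hs Y f (appSec i Y t) y hy
  have hiq' (u : Sec N' Z) : appSec q Z (appSec i Z u) = 0 := congr(appSec $hiq Z u)
  obtain ⟨Z', g', hZ', d, hd⟩ := hr.2 Z (g ≫ f) a (by
    simp only [← appSec_res, ← appSec_lc]
    rw [ha, ← appSec_res, hiq']) y hZ
  refine ⟨Z', g' ≫ g, hZ', d, hi Z' ?_⟩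
  rw [appSec_lc, appSec_res, res_comp, ← ha, res_lc, ← hd, lc_lcRow]
  simp only [appSec_res, hn, res_lc, ← res_comp, res_assoc]

include hi in
lemma RelGen.of_relGen {W : C} {I K L : Type} [Fintype I] [Fintype K] [Fintype L]
    {s : I → Sec N W} {r : K → I → Coef R W}
    (hr : RelGen pt (fun j => appSec q W (s j)) r)
    {n : K → Sec N' W} (hn : ∀ k, appSec i W (n k) = lc s (r k))
    {e : L → K → Coef R W} (he : RelGen pt n e) : RelGen pt s fun l => lcRow r (e l) := by
  refine ⟨fun l => ?_, fun Y f a ha y hy => ?_⟩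
  · rw [lc_lcRow]
    simp only [← hn]
    rw [← appSec_lc, he.1, map_zero]
  · obtain ⟨Z, g, hZ, d, hd⟩ := hr.2 Y f a (by
      simp only [← appSec_res, ← appSec_lc]
      rw [ha, map_zero]) y hy
    obtain ⟨Z', g', hZ', d', hd'⟩ := he.2 Z (g ≫ f) d (hi Z (by
      rw [appSec_lc, map_zero]
      simp only [appSec_res, hn, res_lc]
      rw [← lc_lcRow, hd]
      simp only [res_comp]
      rw [← res_lc, ha, map_zero])) y hZ
    refine ⟨Z', g' ≫ g, hZ', d', ?_⟩
    rw [resRow_comp, ← hd, resRow_lcRow, ← hd', lcRow_lcRow]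
    simp only [resRow_lcRow, ← resRow_comp, Category.assoc]

variable (hq : ∀ (Y : C) (t : Sec N'' Y), ∀ y ∈ pt Y, ∃ (Z : C) (g : Z ⟶ Y), y ∈ pt Z ∧
  ∃ u, appSec q Z u = CoherentSheaves.res N'' g t)

include hq in
lemma Gen.map {W : C} {I : Type} [Fintype I] {s : I → Sec N W} (hs : Gen pt s) :
    Gen pt fun j => appSec q W (s j) := by
  intro Y f t y hy
  obtain ⟨Z, g, hZ, u, hu⟩ := hq Y t y hy
  obtain ⟨Z', g', hZ', a, ha⟩ := hs Z (g ≫ f) u y hZ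
  refine ⟨Z', g' ≫ g, hZ', a, ?_⟩
  rw [res_comp, ← hu, ← appSec_res, ← ha, appSec_lc]
  simp only [appSec_res, res_assoc]

include hq in
lemma LFGs.map (hN : LFGs pt N) : LFGs pt N'' := by
  intro W x hx
  obtain ⟨V, h, hV, I, _, _, s, hs⟩ := hN W x hx
  exact ⟨V, h, hV, I, inferInstance, inferInstance, _, hs.map hq⟩

include hi hiq hexact hq in
/-- If `N` is locally finitely generated, its quotient `N''` is locally finitely presented, and
the kernel `N'` is locally finitely presented as soon as it is locally finitely generated,
then `N` is locally finitely presented. -/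
lemma LFPs.extension (hN : LFGs pt N) (hN'' : LFPs pt N'') (hN' : LFGs pt N' → LFPs pt N') :
    LFPs pt N := by
  have key (W : C) (x : P) (hx : x ∈ pt W) : ∃ (V : C) (_ : V ⟶ W), x ∈ pt V ∧
      ∃ (I : Type) (_ : Fintype I) (_ : Nonempty I) (s : I → Sec N V)
        (K : Type) (_ : Fintype K) (_ : Nonempty K) (r : K → I → Coef R V) (n : K → Sec N' V),
        Gen pt s ∧ RelGen pt (fun j => appSec q V (s j)) r ∧
          ∀ k, appSec i V (n k) = lc s (r k) := by
    obtain ⟨V, h, hV, I, _, _, s, hs⟩ := hN W x hx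
    obtain ⟨V₁, h₁, hV₁, K, _, _, r, hr⟩ := hN''.exists_relGen hV (hs.map hq)
    simp only [← appSec_res] at hr
    choose n hn using fun k => hexact V₁ _ ((appSec_lc q _ _).trans (hr.1 k))
    exact ⟨V₁, h₁ ≫ h, hV₁, I, inferInstance, inferInstance, _, K, inferInstance, inferInstance,
      r, n, hs.res h₁, hr, hn⟩
  have hN₁ : LFPs pt N' := hN' fun W x hx => by
    obtain ⟨V, h, hV, I, _, _, s, K, _, _, r, n, hs, hr, hn⟩ := key W x hx
    exact ⟨V, h, hV, K, inferInstance, inferInstance, n, hs.of_relGen hi hr hiq hn⟩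
  intro W x hx
  obtain ⟨V, h, hV, I, _, _, s, K, _, _, r, n, hs, hr, hn⟩ := key W x hx
  obtain ⟨V₁, h₁, hV₁, L, _, _, e, he⟩ := hN₁.exists_relGen hV (hs.of_relGen hi hr hiq hn)
  have hr₁ := hr.res h₁
  simp only [← appSec_res] at hr₁
  refine ⟨V₁, h₁ ≫ h, hV₁, I, inferInstance, inferInstance, _, L, inferInstance, inferInstance, _,
    hs.res h₁, RelGen.of_relGen hi hr₁ (fun k => ?_) he⟩
  rw [appSec_res, hn, res_lc]

end Extension

end Relations

lemma mono_iff_injective {M N : SheafOfModules.{u} R} (φ : M ⟶ N) :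
    Mono φ ↔ ∀ Y, Function.Injective (appSec φ Y) := by
  constructor
  · intro h Y
    have : Mono ((SheafOfModules.evaluation R (op Y)).map φ) := inferInstance
    exact (ModuleCat.mono_iff_injective _).1 this
  · intro h
    have : Mono ((SheafOfModules.forget R).map φ) :=
      PresheafOfModules.mono_of_injective fun X => h X.unop
    exact (SheafOfModules.forget R).mono_of_mono_map this

variable [HasSheafify J AddCommGrpCat.{u}] [J.WEqualsLocallyBijective AddCommGrpCat.{u}]

lemma exact_sections (S : ShortComplex (SheafOfModules.{u} R)) [Mono S.f]
    (hS : S.Exact) (Y : C) (s : Sec S.X₂ Y) (hs : appSec S.g Y s = 0) :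
    ∃ t, appSec S.f Y t = s := by
  have : (SheafOfModules.evaluation R (op Y)).PreservesZeroMorphisms := ⟨fun _ _ => rfl⟩
  have := hS.map_of_mono_of_preservesKernel (SheafOfModules.evaluation R (op Y)) inferInstance
    inferInstance
  exact (ShortComplex.moduleCat_exact_iff _).1 this s hs

lemma isLocallySurjective_of_epi {M N : SheafOfModules.{u} R} (φ : M ⟶ N) [Epi φ] :
    PresheafOfModules.IsLocallySurjective J φ.val := by
  let adj := PresheafOfModules.sheafificationAdjunction (J := J) (𝟙 R.obj)
  let π := cokernel.π φ.val
  let P := (PresheafOfModules.sheafification (J := J) (𝟙 R.obj)).obj (cokernel φ.val)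
  let η : cokernel φ.val ⟶ P.val := adj.unit.app (cokernel φ.val)
  let c : N ⟶ P := ⟨π ≫ η⟩
  have hc : c = 0 := by
    rw [← cancel_epi φ, comp_zero]
    ext1
    exact (cokernel.condition_assoc φ.val η).trans zero_comp
  refine ⟨fun {Y} t => ?_⟩
  have hinj : Presheaf.IsLocallyInjective J
    (CategoryTheory.toSheafify J (cokernel φ.val).presheaf) := inferInstance
  have ht : ((CategoryTheory.toSheafify J (cokernel φ.val).presheaf).app (op Y)) (π.app (op Y) t)
      = ((CategoryTheory.toSheafify J (cokernel φ.val).presheaf).app (op Y)) 0 := by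
    rw [map_zero]
    exact congr(appSec $hc Y t)
  refine J.superset_covering ?_ (Presheaf.equalizerSieve_mem J _ _ _ ht)
  intro Z g hg
  have hS := (ShortComplex.exact_cokernel φ.val).map (PresheafOfModules.evaluation R.obj (op Z))
  refine (ShortComplex.moduleCat_exact_iff _).1 hS (res N g t) ?_
  refine (PresheafOfModules.naturality_apply π g.op t).trans ?_
  refine Eq.trans hg (map_zero _)

omit [HasSheafify J AddCommGrpCat.{u}] [J.WEqualsLocallyBijective AddCommGrpCat.{u}] in
lemma epi_of_isLocallySurjective {M N : SheafOfModules.{u} R} (φ : M ⟶ N)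
    (h : PresheafOfModules.IsLocallySurjective J φ.val) : Epi φ := by
  have : Epi ((SheafOfModules.toSheaf R).map φ) :=
    have : Sheaf.IsLocallySurjective ((SheafOfModules.toSheaf R).map φ) := h
    inferInstance
  exact (SheafOfModules.toSheaf R).epi_of_epi_map this

/-- A family of subsets `pt Y` of a type of points, indexed by the objects of a site, such that
covering sieves are the pointwise covering ones. -/
def IsPointed {P : Type*} (J : GrothendieckTopology C) (pt : C → Set P) : Prop :=
  ∀ (Y : C) (S : Sieve Y), S ∈ J Y ↔ ∀ y ∈ pt Y, ∃ (Z : C) (f : Z ⟶ Y), y ∈ pt Z ∧ S f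

omit [HasSheafify J AddCommGrpCat.{u}] [J.WEqualsLocallyBijective AddCommGrpCat.{u}] in
lemma IsPointed.over {P : Type*} {pt : C → Set P} (hpt : IsPointed J pt) (W : C) :
    IsPointed (J.over W) (fun Y => pt Y.left) := by
  intro Y S
  rw [GrothendieckTopology.mem_over_iff, hpt]
  refine forall₂_congr fun y _ => ⟨?_, ?_⟩
  · rintro ⟨Z, f, hy, hf⟩
    exact ⟨Over.mk (f ≫ Y.hom), Over.homMk f, hy, (Sieve.overEquiv_iff _ _).1 hf⟩
  · rintro ⟨Z, f, hy, hf⟩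
    refine ⟨Z.left, f.left, hy, (Sieve.overEquiv_iff _ _).2 ?_⟩
    have h := S.downward_closed hf (Over.homMk (𝟙 _) : Over.mk (f.left ≫ Y.hom) ⟶ Z)
    convert h using 1
    ext
    simp

variable {P : Type*} {pt : C → Set P}

lemma epi_iff (hpt : IsPointed J pt) {M N : SheafOfModules.{u} R} (φ : M ⟶ N) :
    Epi φ ↔ ∀ (Y : C) (t : Sec N Y), ∀ y ∈ pt Y, ∃ (Z : C) (g : Z ⟶ Y), y ∈ pt Z ∧
      ∃ u, appSec φ Z u = res N g t := by
  constructor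
  · intro h Y t
    exact (hpt _ _).1 ((isLocallySurjective_of_epi φ).imageSieve_mem t)
  · intro h
    refine epi_of_isLocallySurjective φ ⟨fun {Y} t => (hpt _ _).2 (h Y t)⟩

lemma exact_iff (hpt : IsPointed J pt) (S : ShortComplex (SheafOfModules.{u} R)) :
    S.Exact ↔ ∀ (Y : C) (t : Sec S.X₂ Y), appSec S.g Y t = 0 → ∀ y ∈ pt Y,
      ∃ (Z : C) (g : Z ⟶ Y), y ∈ pt Z ∧ ∃ u, appSec S.f Z u = res S.X₂ g t := by
  have hκ (Z : C) (u : Sec S.X₁ Z) :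
      appSec (kernel.ι S.g) Z (appSec (kernel.lift S.g S.f S.zero) Z u) = appSec S.f Z u :=
    congr(appSec $(kernel.lift_ι S.g S.f S.zero) Z u)
  have hinj := (mono_iff_injective (kernel.ι S.g)).1 inferInstance
  rw [S.exact_iff_epi_kernel_lift, epi_iff hpt]
  constructor
  · intro h Y t ht y hy
    obtain ⟨t, rfl⟩ := exact_sections (.mk _ _ (kernel.condition S.g))
      (ShortComplex.exact_kernel S.g) Y t ht
    obtain ⟨Z, g, hZ, u, hu⟩ := h Y t y hy
    exact ⟨Z, g, hZ, u, by rw [← hκ, hu, appSec_res]⟩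
  · intro h Y t y hy
    obtain ⟨Z, g, hZ, u, hu⟩ := h Y (appSec (kernel.ι S.g) Y t)
      congr(appSec $(kernel.condition S.g) Y t) y hy
    exact ⟨Z, g, hZ, u, hinj Z (by rw [hκ, hu, appSec_res])⟩

section Free

open SheafOfModules

/-- The basis sections of a free sheaf of modules. -/
noncomputable def basisSec {I : Type u} (i : I) (Y : C) : Sec (free (R := R) I) Y :=
  (freeSection (R := R) i).1 (op Y)

lemma res_basisSec {I : Type u} (i : I) {Y Z : C} (f : Z ⟶ Y) :
    res (free (R := R) I) f (basisSec i Y) = basisSec i Z :=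
  (freeSection (R := R) i).2 f.op

open Classical in
/-- The coordinate projections of a free sheaf of modules. -/
noncomputable def freeProj {I : Type u} (j : I) : free (R := R) I ⟶ unit R :=
  Cofan.IsColimit.desc (isColimitFreeCofan I) fun i => if i = j then 𝟙 _ else 0

open Classical in
lemma ιFree_freeProj {I : Type u} (i j : I) :
    ιFree (R := R) i ≫ freeProj j = if i = j then 𝟙 _ else 0 :=
  Cofan.IsColimit.fac (isColimitFreeCofan I) _ _

lemma sum_freeProj {I : Type u} [Fintype I] :
    ∑ j : I, freeProj (R := R) j ≫ ιFree j = 𝟙 _ := by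
  classical
  refine Cofan.IsColimit.hom_ext (isColimitFreeCofan I) _ _ fun i => ?_
  have h : ιFree (R := R) i ≫ ∑ j, freeProj j ≫ ιFree j = ιFree i ≫ 𝟙 _ := by
    rw [Preadditive.comp_sum, Category.comp_id, Finset.sum_eq_single i]
    · rw [← Category.assoc, ιFree_freeProj, if_pos rfl, Category.id_comp]
    · intro j _ hj
      rw [← Category.assoc, ιFree_freeProj, if_neg hj.symm, zero_comp]
    · simp
  exact h

/-- The coordinates of a section of a free sheaf of modules. -/
noncomputable def coord {I : Type u} (Y : C) (a : Sec (free (R := R) I) Y) (i : I) : Coef R Y :=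
  appSec (freeProj i) Y a

omit [HasSheafify J AddCommGrpCat.{u}] [J.WEqualsLocallyBijective AddCommGrpCat.{u}] in
lemma appSec_sum {M N : SheafOfModules.{u} R} {I : Type*} (s : Finset I) (φ : I → (M ⟶ N)) (Y : C)
    (a : Sec M Y) : appSec (∑ i ∈ s, φ i) Y a = ∑ i ∈ s, appSec (φ i) Y a := by
  classical
  induction s using Finset.induction_on with
  | empty => rw [Finset.sum_empty, Finset.sum_empty]; rfl
  | insert i s hi ih => rw [Finset.sum_insert hi, Finset.sum_insert hi, ← ih]; rfl

lemma appSec_ιFree {I : Type u} (Y : C) (i : I) (a : Coef R Y) :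
    appSec (ιFree (R := R) i) Y a = a • basisSec i Y := by
  have h : appSec (ιFree (R := R) i) Y (1 : Coef R Y) = basisSec i Y := rfl
  rw [← h]
  exact (congrArg (appSec (ιFree i) Y) (mul_one a).symm).trans
    ((appSec (ιFree (R := R) i) Y).map_smul a (1 : Coef R Y))

lemma sum_coord {I : Type u} [Fintype I] (Y : C) (a : Sec (free (R := R) I) Y) :
    ∑ i, coord Y a i • basisSec i Y = a := by
  have h : appSec (∑ j : I, freeProj (R := R) j ≫ ιFree j) Y a = a :=
    congr(appSec $(sum_freeProj (R := R) (I := I)) Y a)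
  rw [appSec_sum] at h
  refine Eq.trans (Finset.sum_congr rfl fun i _ => ?_) h
  exact (appSec_ιFree Y i _).symm

lemma coord_sum {I : Type u} [Fintype I] (Y : C) (a : I → Coef R Y) :
    coord Y (∑ i, a i • basisSec i Y) = a := by
  classical
  ext j
  have h (i : I) : appSec (freeProj j) Y (a i • basisSec i Y) = if i = j then a i else 0 := by
    rw [← appSec_ιFree]
    have := congr(appSec $(ιFree_freeProj (R := R) i j) Y (a i))
    refine Eq.trans this ?_
    split_ifs <;> rfl
  unfold coord
  rw [map_sum]
  refine (Finset.sum_congr rfl fun i _ => h i).trans ?_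
  exact Fintype.sum_ite_eq' j a

lemma coord_res {I : Type u} {Y Z : C} (f : Z ⟶ Y) (a : Sec (free (R := R) I) Y) (i : I) :
    coord Z (res (free I) f a) i = resR R f (coord Y a i) :=
  appSec_res (freeProj i) f a

lemma coord_injective {I : Type u} [Fintype I] (Y : C) :
    Function.Injective (coord (R := R) (I := I) Y) := by
  intro a b h
  rw [← sum_coord Y a, ← sum_coord Y b, h]

lemma coord_lc {I : Type u} {K : Type*} [Fintype K] {Y : C} (x : K → Sec (free (R := R) I) Y)
    (a : K → Coef R Y) : coord Y (lc x a) = lcRow (fun k => coord Y (x k)) a := by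
  ext i
  refine (appSec_lc (freeProj i) x a).trans ?_
  rw [Fintype.linearCombination_apply, Fintype.linearCombination_apply, Finset.sum_apply]
  rfl

variable {T : C} (hT : IsTerminal T)

include hT in
lemma exists_hom_free {I : Type u} (M : SheafOfModules.{u} R) (s : I → Sec M T) :
    ∃ p : free I ⟶ M, ∀ i, appSec p T (basisSec i T) = s i := by
  refine ⟨M.freeHomEquiv.symm fun i => PresheafOfModules.sectionsMk
    (fun Y => res M (hT.from Y.unop) (s i)) fun Y Z f => ?_, fun i => ?_⟩
  · refine (res_comp M f.unop (hT.from Y.unop) (s i)).symm.trans ?_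
    rw [hT.hom_ext (f.unop ≫ hT.from Y.unop) (hT.from Z.unop)]
  · refine congr(($(sectionsMap_freeHomEquiv_symm_freeSection _ i)).1 (op T)).trans ?_
    change res M (hT.from T) (s i) = s i
    rw [hT.hom_ext (hT.from T) (𝟙 T)]
    exact congr($(M.val.map_id (op T)) (s i))

lemma appSec_free {I : Type u} [Fintype I] {M : SheafOfModules.{u} R} (p : free I ⟶ M) {Y : C}
    (a : Sec (free (R := R) I) Y) :
    appSec p Y a = lc (fun i => res M (hT.from Y) (appSec p T (basisSec i T))) (coord Y a) := by
  conv_lhs => rw [← sum_coord Y a, ← Fintype.linearCombination_apply, appSec_lc]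
  simp only [← appSec_res, res_basisSec]

lemma appSec_free_lc {I : Type u} [Fintype I] {M : SheafOfModules.{u} R} (p : free I ⟶ M) {Y : C}
    (a : I → Coef R Y) :
    appSec p Y (lc (fun i => basisSec i Y) a) =
      lc (fun i => res M (hT.from Y) (appSec p T (basisSec i T))) a := by
  rw [appSec_lc]
  simp only [← appSec_res, res_basisSec]

include hT in
lemma epi_iff_gen (hpt : IsPointed J pt) {I : Type u} [Fintype I] {M : SheafOfModules.{u} R}
    (p : free I ⟶ M) : Epi p ↔ Gen pt fun i => appSec p T (basisSec i T) := by
  rw [epi_iff hpt]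
  refine ⟨fun h Y f t y hy => ?_, fun h Y t y hy => ?_⟩
  · obtain ⟨Z, g, hZ, v, hv⟩ := h Y t y hy
    refine ⟨Z, g, hZ, coord Z v, ?_⟩
    rw [hT.hom_ext (g ≫ f) (hT.from Z), ← appSec_free, hv]
  · obtain ⟨Z, g, hZ, a, ha⟩ := h Y (hT.from Y) t y hy
    refine ⟨Z, g, hZ, lc (fun i => basisSec i Z) a, ?_⟩
    rw [appSec_free_lc hT, ← ha, hT.hom_ext (g ≫ hT.from Y) (hT.from Z)]

lemma coord_appSec_free {I K : Type u} [Fintype K]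
    (f : free (R := R) K ⟶ free I) {Y : C} (a : Sec (free (R := R) K) Y) :
    coord Y (appSec f Y a) =
      lcRow (fun k => resRow R (hT.from Y) (coord T (appSec f T (basisSec k T)))) (coord Y a) := by
  rw [appSec_free hT, coord_lc]
  congr 2
  ext k i
  exact coord_res (hT.from Y) _ i

omit [HasSheafify J AddCommGrpCat.{u}] [J.WEqualsLocallyBijective AddCommGrpCat.{u}] in
lemma hom_ext_appSec {M N : SheafOfModules.{u} R} {φ ψ : M ⟶ N}
    (h : ∀ Y a, appSec φ Y a = appSec ψ Y a) : φ = ψ := by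
  ext Y a
  exact h Y.unop a

lemma lc_coord {I : Type u} [Fintype I] {M : SheafOfModules.{u} R} (p : free I ⟶ M)
    (a : Sec (free (R := R) I) T) :
    lc (fun i => appSec p T (basisSec i T)) (coord T a) = appSec p T a := by
  conv_rhs => rw [← sum_coord T a, ← Fintype.linearCombination_apply, appSec_lc]

include hT in
lemma relGen_of_exact (hpt : IsPointed J pt) {I K : Type u} [Fintype I] [Fintype K]
    {M : SheafOfModules.{u} R} (p : free I ⟶ M) (f : free K ⟶ free I) (w : f ≫ p = 0)
    (h : (ShortComplex.mk f p w).Exact) :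
    RelGen pt (fun i => appSec p T (basisSec i T))
      fun k => coord T (appSec f T (basisSec k T)) := by
  rw [exact_iff hpt] at h
  refine ⟨fun k => ?_, fun Y g a ha y hy => ?_⟩
  · rw [lc_coord]
    exact congr(appSec $w T (basisSec k T))
  · obtain rfl := hT.hom_ext g (hT.from Y)
    obtain ⟨Z, g, hZ, v, hv⟩ := h Y (lc (fun i => basisSec i Y) a)
      ((appSec_free_lc hT p a).trans ha) y hy
    refine ⟨Z, g, hZ, coord Z v, ?_⟩
    rw [hT.hom_ext (g ≫ hT.from Y) (hT.from Z), ← coord_appSec_free hT]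
    refine congr(coord Z $hv).trans ?_
    ext i
    refine (coord_res _ _ _).trans ?_
    rw [Fintype.linearCombination_apply, coord_sum]

include hT in
lemma exists_presentation (hpt : IsPointed J pt) {I K : Type u} [Fintype I] [Fintype K]
    {M : SheafOfModules.{u} R} {s : I → Sec M T} {r : K → I → Coef R T} (hs : Gen pt s)
    (hr : RelGen pt s r) : ∃ (f : free (R := R) K ⟶ free I) (p : free I ⟶ M) (w : f ≫ p = 0),
      Epi p ∧ (ShortComplex.mk f p w).Exact := by
  obtain ⟨p, hp⟩ := exists_hom_free hT M s
  obtain ⟨f, hf⟩ := exists_hom_free hT (free (R := R) I) fun k => lc (fun i => basisSec i T) (r k)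
  obtain rfl : (fun i => appSec p T (basisSec i T)) = s := funext hp
  have hr' : (fun k => coord T (appSec f T (basisSec k T))) = r := by
    ext1 k
    rw [hf, Fintype.linearCombination_apply, coord_sum]
  subst hr'
  have w : f ≫ p = 0 := hom_ext_appSec fun Y a => by
    change appSec p Y (appSec f Y a) = 0
    rw [appSec_free hT p, coord_appSec_free hT, lc_lcRow]
    simp only [← res_lc, hr.1, map_zero]
    rw [Fintype.linearCombination_apply]
    simp
  refine ⟨f, p, w, (epi_iff_gen hT hpt p).2 hs, (exact_iff hpt _).2 fun Y t ht y hy => ?_⟩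
  obtain ⟨Z, g, hZ, d, hd⟩ := hr.2 Y (hT.from Y) (coord Y t) ((appSec_free hT p t).symm.trans ht)
    y hy
  refine ⟨Z, g, hZ, lc (fun k => basisSec k Z) d, coord_injective Z ?_⟩
  refine (coord_appSec_free hT f _).trans ?_
  rw [Fintype.linearCombination_apply _ _ d, coord_sum, hT.hom_ext (hT.from Z) (g ≫ hT.from Y), hd]
  exact funext fun i => (coord_res g t i).symm

end Free

section Over

omit [HasSheafify J AddCommGrpCat.{u}] [J.WEqualsLocallyBijective AddCommGrpCat.{u}]

lemma gen_over_iff {I : Type*} [Fintype I] (N : SheafOfModules.{u} R) {W : C} (s : I → Sec N W) :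
    Gen (fun Y : Over W => pt Y.left) (N := N.over W) (W := Over.mk (𝟙 W)) s ↔ Gen pt s := by
  refine ⟨fun h Y f t y hy => ?_, fun h Y f t y hy => ?_⟩
  · obtain ⟨Z, g, hZ, a, ha⟩ := h (Over.mk f) (Over.homMk f) t y hy
    exact ⟨Z.left, g.left, hZ, a, ha⟩
  · obtain ⟨Z, g, hZ, a, ha⟩ := h Y.left f.left t y hy
    exact ⟨Over.mk (g ≫ Y.hom), Over.homMk g, hZ, a, ha⟩

lemma relGen_over_iff {I K : Type*} [Fintype I] [Fintype K] (N : SheafOfModules.{u} R) {W : C}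
    (s : I → Sec N W) (r : K → I → Coef R W) :
    RelGen (fun Y : Over W => pt Y.left) (N := N.over W) (W := Over.mk (𝟙 W)) s r ↔
      RelGen pt s r := by
  refine and_congr Iff.rfl ⟨fun h Y f a ha y hy => ?_, fun h Y f a ha y hy => ?_⟩
  · obtain ⟨Z, g, hZ, a, ha⟩ := h (Over.mk f) (Over.homMk f) a ha y hy
    exact ⟨Z.left, g.left, hZ, a, ha⟩
  · obtain ⟨Z, g, hZ, a, ha⟩ := h Y.left f.left a ha y hy
    exact ⟨Over.mk (g ≫ Y.hom), Over.homMk g, hZ, a, ha⟩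

end Over

section Fin

omit [HasSheafify J AddCommGrpCat.{u}] [J.WEqualsLocallyBijective AddCommGrpCat.{u}]

variable {W : C}

lemma Gen.reindex {I I' : Type*} [Fintype I] [Fintype I'] (e : I' ≃ I) {N : SheafOfModules.{u} R}
    {s : I → Sec N W} (hs : Gen pt s) : Gen pt (s ∘ e) := by
  intro Y f t y hy
  obtain ⟨Z, g, hZ, a, ha⟩ := hs Y f t y hy
  refine ⟨Z, g, hZ, a ∘ e, ?_⟩
  rw [← ha, Fintype.linearCombination_apply, Fintype.linearCombination_apply]
  exact e.sum_comp fun i => a i • CoherentSheaves.res N (g ≫ f) (s i)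

lemma RelGen.reindex {I I' K K' : Type*} [Fintype I] [Fintype I'] [Fintype K] [Fintype K']
    (e : I' ≃ I) (e' : K' ≃ K) {N : SheafOfModules.{u} R} {s : I → Sec N W}
    {r : K → I → Coef R W} (hr : RelGen pt s r) :
    RelGen pt (s ∘ e) fun k => r (e' k) ∘ e := by
  refine ⟨fun k => ?_, fun Y f a ha y hy => ?_⟩
  · rw [← hr.1 (e' k), Fintype.linearCombination_apply, Fintype.linearCombination_apply]
    exact e.sum_comp fun i => r (e' k) i • s i
  · obtain ⟨Z, g, hZ, d, hd⟩ := hr.2 Y f (a ∘ e.symm) (by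
      rw [← ha, Fintype.linearCombination_apply, Fintype.linearCombination_apply, ← e.sum_comp]
      simp) y hy
    refine ⟨Z, g, hZ, d ∘ e', ?_⟩
    ext i
    have h : _ = resRow R g a i := (congr_fun hd (e i)).trans (by simp [resRow])
    simp only [Fintype.linearCombination_apply, Finset.sum_apply, Pi.smul_apply] at h ⊢
    rw [← h]
    exact e'.sum_comp fun k => d k • resRow R (g ≫ f) (r k) (e i)

open SheafOfModules

variable [HasSheafify (J.over W) AddCommGrpCat.{u}]
  [(J.over W).WEqualsLocallyBijective AddCommGrpCat.{u}]

lemma exists_gen_of_epi (hpt : IsPointed J pt) {N : SheafOfModules.{u} R} {I : Type} [Fintype I]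
    (p : free (ULift.{u} I) ⟶ N.over W) [Epi p] : ∃ s : I → Sec N W, Gen pt s :=
  ⟨_, ((gen_over_iff N _).1 ((epi_iff_gen Over.mkIdTerminal (hpt.over W) p).1 inferInstance)).reindex
    Equiv.ulift.symm⟩

lemma exists_relGen_of_exact (hpt : IsPointed J pt) {N : SheafOfModules.{u} R} {I K : Type}
    [Fintype I] [Fintype K] (f : free (ULift.{u} K) ⟶ free (ULift.{u} I))
    (p : free (ULift.{u} I) ⟶ N.over W) (w : f ≫ p = 0) [Epi p]
    (h : (ShortComplex.mk f p w).Exact) :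
    ∃ (s : I → Sec N W) (r : K → I → Coef R W), Gen pt s ∧ RelGen pt s r :=
  ⟨_, _, ((gen_over_iff N _).1
      ((epi_iff_gen Over.mkIdTerminal (hpt.over W) p).1 inferInstance)).reindex Equiv.ulift.symm,
    ((relGen_over_iff N _ _).1
      (relGen_of_exact Over.mkIdTerminal (hpt.over W) p f w h)).reindex
        Equiv.ulift.symm Equiv.ulift.symm⟩

lemma exists_epi_of_gen (hpt : IsPointed J pt) {N : SheafOfModules.{u} R} {I : Type} [Fintype I]
    [Nonempty I] {s : I → Sec N W} (hs : Gen pt s) :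
    ∃ n : ℕ, 0 < n ∧ ∃ p : free (ULift.{u} (Fin n)) ⟶ N.over W, Epi p := by
  refine ⟨Fintype.card I, Fintype.card_pos, ?_⟩
  have hs' := (gen_over_iff N _).2 (hs.reindex (Equiv.ulift.trans (Fintype.equivFin I).symm))
  obtain ⟨p, hp⟩ := exists_hom_free Over.mkIdTerminal (N.over W)
    (s ∘ (Equiv.ulift.trans (Fintype.equivFin I).symm))
  refine ⟨p, (epi_iff_gen Over.mkIdTerminal (hpt.over W) p).2 ?_⟩
  rwa [show (fun i => appSec p _ (basisSec i _)) = _ from funext hp]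

lemma exists_presentation_of_relGen (hpt : IsPointed J pt) {N : SheafOfModules.{u} R}
    {I K : Type} [Fintype I] [Fintype K] [Nonempty I] [Nonempty K] {s : I → Sec N W}
    {r : K → I → Coef R W} (hs : Gen pt s) (hr : RelGen pt s r) :
    ∃ m n : ℕ, 0 < m ∧ 0 < n ∧
      ∃ (f : (free (ULift.{u} (Fin m)) : SheafOfModules.{u} (R.over W)) ⟶
          free (ULift.{u} (Fin n)))
        (p : free (ULift.{u} (Fin n)) ⟶ N.over W) (w : f ≫ p = 0),
        Epi p ∧ (ShortComplex.mk f p w).Exact :=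
  ⟨Fintype.card K, Fintype.card I, Fintype.card_pos, Fintype.card_pos,
    exists_presentation Over.mkIdTerminal (hpt.over W)
      ((gen_over_iff N _).2 (hs.reindex (Equiv.ulift.trans (Fintype.equivFin I).symm)))
      ((relGen_over_iff N _ _).2 (hr.reindex (Equiv.ulift.trans (Fintype.equivFin I).symm)
        (Equiv.ulift.trans (Fintype.equivFin K).symm)))⟩

end Fin

end Site

section Space

/-- The points of an open subset, seen as an object of a slice of the site of open subsets. -/
abbrev ptOver (U : Opens X) (Y : Over U) : Set X := (Y.left : Set X)

lemma isPointed_opens (X : TopCat.{u}) :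
    IsPointed (Opens.grothendieckTopology X) fun U : Opens X => (U : Set X) := by
  intro U S
  refine forall₂_congr fun x _ => ⟨?_, ?_⟩
  · rintro ⟨V, f, hf, hx⟩
    exact ⟨V, f, hx, hf⟩
  · rintro ⟨V, f, hx, hf⟩
    exact ⟨V, f, hf, hx⟩

lemma isPointed_over (U : Opens X) :
    IsPointed ((Opens.grothendieckTopology X).over U) (ptOver U) :=
  (isPointed_opens X).over U

lemma exists_inf {U V : Opens X} (h : V ≤ U) (W : Over U) {x : X} (hV : x ∈ V)
    (hW : x ∈ ptOver U W) :
    ∃ (Y : Over U) (_ : Y ⟶ W) (_ : Y ⟶ Over.mk (homOfLE h)), x ∈ ptOver U Y :=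
  ⟨Over.mk (homOfLE (inf_le_right.trans h) : W.left ⊓ V ⟶ U), Over.homMk (homOfLE inf_le_left),
    Over.homMk (homOfLE inf_le_right), hW, hV⟩

lemma isLFGOver_iff {U : Opens X} (N : SheafOfModules.{u} (R.over U)) :
    IsLFGOver N ↔ LFGs (ptOver U) N := by
  constructor
  · intro hN W x hx
    obtain ⟨V, h, hV, n, hn, p, hp⟩ := hN x (leOfHom W.hom hx)
    obtain ⟨s, hs⟩ := exists_gen_of_epi (isPointed_over U) p
    obtain ⟨Y, f, g, hY⟩ := exists_inf h W hV hx
    exact ⟨Y, f, hY, Fin n, inferInstance, Fin.pos_iff_nonempty.1 hn, _, hs.res g⟩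
  · intro hN x hx
    obtain ⟨V, h, hV, I, _, _, s, hs⟩ := hN (Over.mk (𝟙 U)) x hx
    exact ⟨V.left, leOfHom h.left, hV, exists_epi_of_gen (isPointed_over U)
      (hs.res (Over.homMk (𝟙 _) : Over.mk (homOfLE (leOfHom h.left)) ⟶ V))⟩

lemma isLFPOver_iff {U : Opens X} (N : SheafOfModules.{u} (R.over U)) :
    IsLFPOver N ↔ LFPs (ptOver U) N := by
  constructor
  · intro hN W x hx
    obtain ⟨V, h, hV, m, n, hm, hn, f, p, w, hp, hf⟩ := hN x (leOfHom W.hom hx)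
    obtain ⟨s, r, hs, hr⟩ := exists_relGen_of_exact (isPointed_over U) f p w hf
    obtain ⟨Y, f, g, hY⟩ := exists_inf h W hV hx
    exact ⟨Y, f, hY, Fin n, inferInstance, Fin.pos_iff_nonempty.1 hn, _,
      Fin m, inferInstance, Fin.pos_iff_nonempty.1 hm, _, hs.res g, hr.res g⟩
  · intro hN x hx
    obtain ⟨V, h, hV, I, _, _, s, K, _, _, r, hs, hr⟩ := hN (Over.mk (𝟙 U)) x hx
    let g : Over.mk (homOfLE (leOfHom h.left)) ⟶ V := Over.homMk (𝟙 _)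
    exact ⟨V.left, leOfHom h.left, hV, exists_presentation_of_relGen (isPointed_over U)
      (hs.res g) (hr.res g)⟩

/-- In a short exact sequence whose outer terms are pseudo-coherent, the middle term is
pseudo-coherent. -/
lemma IsPseudoCoherent.of_shortExact {S : ShortComplex (SheafOfModules.{u} R)}
    (hS : S.ShortExact) (h₁ : IsPseudoCoherent S.X₁) (h₃ : IsPseudoCoherent S.X₃) :
    IsPseudoCoherent S.X₂ := by
  intro U N ι hι hN
  have := hS.mono_f
  let T : ShortComplex (SheafOfModules.{u} (R.over U)) :=
    ShortComplex.mk (resMap S.f U) (resMap S.g U)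
      (hom_ext_appSec fun Y a => congr(appSec $S.zero Y.left a))
  have : Mono T.f := (mono_iff_injective T.f).2 fun Y =>
    (mono_iff_injective S.f).1 hS.mono_f Y.left
  have hT : T.Exact := (exact_iff (isPointed_over U) T).2 fun Y t ht y hy => by
    obtain ⟨v, rfl⟩ := exact_sections S hS.exact Y.left t ht
    exact ⟨Y, 𝟙 Y, hy, res T.X₁ (𝟙 Y) v, appSec_res T.f (𝟙 Y) v⟩
  let φ : N ⟶ T.X₃ := ι ≫ T.g
  have hφ : φ = factorThruImage φ ≫ image.ι φ := (image.fac φ).symm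
  let k : kernel φ ⟶ T.X₁ := hT.lift (kernel.ι φ ≫ ι) (by
    rw [Category.assoc]; exact kernel.condition φ)
  have hk : k ≫ T.f = kernel.ι φ ≫ ι := hT.lift_f _ _
  have : Mono k := mono_of_mono_fac hk
  have hq := (epi_iff (isPointed_over U) (factorThruImage φ)).1 inferInstance
  have hN' := (isLFGOver_iff N).1 hN
  refine (isLFPOver_iff N).2 (LFPs.extension (i := kernel.ι φ) (q := factorThruImage φ)
    ((mono_iff_injective _).1 inferInstance) ?_ (fun Y s hs => ?_) hq hN' ?_ ?_)
  · rw [← cancel_mono (image.ι φ), Category.assoc, image.fac, kernel.condition, zero_comp]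
  · refine exact_sections (.mk _ _ (kernel.condition φ)) (ShortComplex.exact_kernel φ) Y s ?_
    refine congr(appSec $hφ Y s).trans ?_
    exact congr(appSec (image.ι φ) Y $hs).trans (map_zero _)
  · exact (isLFPOver_iff _).1 (h₃ U _ (image.ι φ) inferInstance
      ((isLFGOver_iff _).2 (LFGs.map hq hN')))
  · exact fun h => (isLFPOver_iff _).1 (h₁ U _ k inferInstance ((isLFGOver_iff _).2 h))

/-- An extension of locally finitely generated sheaves of modules is locally finitely generated. -/
lemma IsLFG.of_shortExact {S : ShortComplex (SheafOfModules.{u} R)}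
    (hS : S.ShortExact) (h₁ : IsLFG S.X₁) (h₃ : IsLFG S.X₃) : IsLFG S.X₂ := by
  have := hS.mono_f
  have := hS.epi_g
  have hg := (epi_iff (isPointed_opens X) S.g).1 inferInstance
  intro x
  obtain ⟨U₁, hU₁, n, hn, p, hp⟩ := h₁ x
  obtain ⟨U₃, hU₃, m, hm, p', hp'⟩ := h₃ x
  obtain ⟨s, hs⟩ := exists_gen_of_epi (isPointed_opens X) p
  obtain ⟨t, ht⟩ := exists_gen_of_epi (isPointed_opens X) p'
  obtain ⟨V, f, hV, h⟩ := exists_forall_of_finite (pt := fun U : Opens X => (U : Set X))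
    (W := U₁ ⊓ U₃) (y := x) ⟨hU₁, hU₃⟩
    (fun j Z f => ∃ v, appSec S.g Z v = res S.X₃ (f ≫ homOfLE inf_le_right) (t j))
    (by
      rintro j Z Z' f g ⟨v, hv⟩
      exact ⟨res S.X₂ g v, by rw [appSec_res, hv, ← res_comp, res_assoc]⟩)
    (by
      intro j Z f hZ
      obtain ⟨Z', g, hZ', v, hv⟩ := hg Z (res S.X₃ (f ≫ homOfLE inf_le_right) (t j)) x hZ
      exact ⟨Z', g, hZ', v, by rw [hv, ← res_comp, res_assoc]⟩)
  choose v hv using h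
  have := Fin.pos_iff_nonempty.1 hn
  refine ⟨V, hV, exists_epi_of_gen (isPointed_opens X) (Gen.of_shortExact
    (fun Y s hs => exact_sections S hS.exact Y s hs)
    (hs.res (f ≫ homOfLE inf_le_left)) (s := v) ?_)⟩
  simpa only [hv] using ht.res (f ≫ homOfLE inf_le_right)

end Space

/-- In a short exact sequence, if `M'` and `M''` are coherent, then so is `M`. -/
theorem isCoherent_of_isCoherent_isCoherent (S : CategoryTheory.ShortComplex (SheafOfModules.{u} R)) (hS : S.ShortExact)
    (hM' : IsCoherent S.X₁) (hM'' : IsCoherent S.X₃) : IsCoherent S.X₂ :=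
  ⟨IsLFG.of_shortExact hS hM'.1 hM''.1, IsPseudoCoherent.of_shortExact hS hM'.2 hM''.2⟩

end CoherentSheaves
end
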